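/- Under conditions (A1)–(A3), for φ equal to φ1 or φ2 and every K > 0: (i) for every ε > 0, lim_{ρ→0} limsup_n P( sup_{ζ_1,ζ_2 ∈ [−K,K], |ζ_1−ζ_2|<ρ} k^{−1/2} Σ_{i=1}^n |A_i(ζ_2) − A_i(ζ_1)| > ε ) = 0; and (ii) lim_{ρ→0} limsup_n sup_{ζ_1,ζ_2 ∈ [−K,K], |ζ_1−ζ_2|<ρ} (n/√k) E|A_1(ζ_2) − A_1(ζ_1)| = 0. -/

import Mathlib

open MeasureTheory ProbabilityTheory Filter Set
open scoped ProbabilityTheory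

noncomputable section

namespace TailCusum

variable {Ω : Type*} [MeasureSpace Ω]

/-- `φ₁(x) = 1{x > 0}`. -/
def phi1 (x : ℝ) : ℝ := if 0 < x then 1 else 0

/-- `φ₂(x) = x₊ = max {x, 0}`. -/
def phi2 (x : ℝ) : ℝ := max x 0

/-- positive part -/
def pos (x : ℝ) : ℝ := max x 0

/-- A positive measurable function `g` is regularly varying at `∞` with index `ρ` if
`g(λ x)/g(x) → λ^ρ` as `x → ∞` for every `λ > 0`. -/
def RegularlyVarying (g : ℝ → ℝ) (ρ : ℝ) : Prop :=
  Measurable g ∧ ∀ lam : ℝ, 0 < lam →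
    Tendsto (fun x => g (lam * x) / g x) atTop (nhds (lam ^ ρ))

/-- `l` is slowly varying at `∞`. -/
def SlowlyVarying (l : ℝ → ℝ) : Prop :=
  Measurable l ∧ ∀ lam : ℝ, 0 < lam →
    Tendsto (fun x => l (lam * x) / l x) atTop (nhds 1)

/-- `κ(λ) = K ∫_1^λ t^(γ-1) dt`. -/
def kappaFun (K γ : ℝ) (lam : ℝ) : ℝ := K * ∫ t in (1:ℝ)..lam, t ^ (γ - 1)

/-- Second-order regular variation condition on the slowly varying function `l`
(the core of condition (A2)): `(l(λx)/l(x) - 1)/g(x) → κ(λ)` with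
`κ(λ) = K ∫_1^λ t^(γ-1) dt`, `g` positive and regularly varying with index `γ ≤ 0`. -/
def SecondOrderRV (l g : ℝ → ℝ) (K γ : ℝ) : Prop :=
  γ ≤ 0 ∧ (∀ x, 0 < g x) ∧ RegularlyVarying g γ ∧
  ∀ lam : ℝ, 0 < lam →
    Tendsto (fun x => (l (lam * x) / l x - 1) / g x) atTop (nhds (kappaFun K γ lam))

/-- distribution function of a law on `ℝ` -/
def df (μ : Measure ℝ) (x : ℝ) : ℝ := (μ (Iic x)).toReal

/-- tail distribution function `F̄(x) = μ(x, ∞)` -/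
def tailDF (μ : Measure ℝ) (x : ℝ) : ℝ := (μ (Ioi x)).toReal

/-- the quantile-type function `b(x) = inf {y : F(y) ≥ 1 - x⁻¹}` -/
def quantileB (μ : Measure ℝ) (x : ℝ) : ℝ := sInf {y : ℝ | 1 - x⁻¹ ≤ df μ y}

/-- `F̄(x) = x^(-α) l(x)` for `x > 0` with `l` slowly varying: Pareto-type tail. -/
def ParetoTail (μ : Measure ℝ) (α : ℝ) (l : ℝ → ℝ) : Prop :=
  SlowlyVarying l ∧ ∀ x : ℝ, 0 < x → tailDF μ x = x ^ (-α) * l x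

/-- strict stationarity of a sequence of random variables -/
def IsStationary (X : ℕ → Ω → ℝ) : Prop :=
  ∀ j : ℕ,
    Measure.map (fun ω => fun i : ℕ => X (i + j) ω) (ℙ : Measure Ω)
      = Measure.map (fun ω => fun i : ℕ => X i ω) (ℙ : Measure Ω)

/-- strict stationarity, `ℤ`-indexed -/
def IsStationaryZ (X : ℤ → Ω → ℝ) : Prop :=
  ∀ j : ℤ,
    Measure.map (fun ω => fun i : ℤ => X (i + j) ω) (ℙ : Measure Ω)
      = Measure.map (fun ω => fun i : ℤ => X i ω) (ℙ : Measure Ω)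

/-- The β-mixing coefficient of the sequence `X` at lag `lag`, expressed as
the supremum over `m` of the total-variation distance between the joint law of
`(X_1, …, X_m)` and `(X_{m+lag+1}, X_{m+lag+2}, …)` and the product of the two laws. -/
def betaMix (X : ℕ → Ω → ℝ) (lag : ℕ) : ℝ :=
  ⨆ m : ℕ, ⨆ S : Subtype (MeasurableSet : Set ((Fin m → ℝ) × (ℕ → ℝ)) → Prop),
    |((Measure.map
        (fun ω => ((fun i : Fin m => X ((i : ℕ) + 1) ω, fun i : ℕ => X (m + lag + 1 + i) ω)))
        (ℙ : Measure Ω)) S.1).toReal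
      - (((Measure.map (fun ω => fun i : Fin m => X ((i : ℕ) + 1) ω) (ℙ : Measure Ω)).prod
          (Measure.map (fun ω => fun i : ℕ => X (m + lag + 1 + i) ω) (ℙ : Measure Ω))) S.1).toReal|

/-- The tail sample fraction condition: `k → ∞` and `k = o(n)`. -/
def TailFraction (k : ℕ → ℕ) : Prop :=
  Tendsto (fun n : ℕ => (k n : ℝ)) atTop atTop ∧
    Tendsto (fun n : ℕ => (k n : ℝ) / n) atTop (nhds 0)

/-- Condition (A1): `(n / r_n) β([ε r_n]) → 0` for every `ε > 0`, and `r_n² = o(k)`. -/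
def CondA1 (X : ℕ → Ω → ℝ) (k r : ℕ → ℕ) : Prop :=
  (∀ n, 0 < r n) ∧
  (∀ ε : ℝ, 0 < ε →
    Tendsto (fun n : ℕ => ((n : ℝ) / r n) * betaMix X ⌊ε * r n⌋₊) atTop (nhds 0)) ∧
  Tendsto (fun n : ℕ => ((r n : ℝ) ^ 2 / k n)) atTop (nhds 0)

/-- Condition (A2): second-order regular variation of `l` plus
`√k · g(b(n/k)) → A ∈ ℝ`. -/
def CondA2 (l g : ℝ → ℝ) (K γ A : ℝ) (b : ℝ → ℝ) (k : ℕ → ℕ) : Prop :=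
  SecondOrderRV l g K γ ∧
    Tendsto (fun n : ℕ => Real.sqrt (k n) * g (b ((n : ℝ) / k n))) atTop (nhds A)

/-- covariance of two real random variables -/
def cov (f g : Ω → ℝ) : ℝ :=
  ∫ ω, (f ω - ∫ ω', f ω') * (g ω - ∫ ω', g ω')

/-- pairs `1 ≤ i < j ≤ N` -/
def pairsUpTo (N : ℕ) : Finset (ℕ × ℕ) :=
  ((Finset.Icc 1 N) ×ˢ (Finset.Icc 1 N)).filter fun p => p.1 < p.2

/-- Condition (A3): existence of the limits `χ` and `ω` of the normalized sums of
covariances, for every `0 < ε < 1`. -/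
def CondA3 (X : ℕ → Ω → ℝ) (b : ℝ → ℝ) (k r : ℕ → ℕ) (α χ ωc : ℝ) : Prop :=
  0 ≤ χ ∧ 0 ≤ ωc ∧
  ∀ ε : ℝ, 0 < ε → ε < 1 →
    (Tendsto (fun n : ℕ =>
        (2 * α ^ 2 * n / ((⌊ε * r n⌋₊ : ℝ) * k n)) *
          ∑ p ∈ pairsUpTo ⌊ε * r n⌋₊,
            cov (fun ω => pos (Real.log (X p.1 ω) - Real.log (b ((n : ℝ) / k n))))
                (fun ω => pos (Real.log (X p.2 ω) - Real.log (b ((n : ℝ) / k n)))))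
      atTop (nhds χ)) ∧
    (Tendsto (fun n : ℕ =>
        (2 * (n : ℝ) / ((⌊ε * r n⌋₊ : ℝ) * k n)) *
          ∑ p ∈ pairsUpTo ⌊ε * r n⌋₊,
            cov (fun ω => if b ((n : ℝ) / k n) < X p.1 ω then (1 : ℝ) else 0)
                (fun ω => if b ((n : ℝ) / k n) < X p.2 ω then (1 : ℝ) else 0))
      atTop (nhds ωc))

/-- the `k`-th largest value among `X_1, …, X_n` -/
def orderStat (n k : ℕ) (X : ℕ → Ω → ℝ) (ω : Ω) : ℝ :=
  sInf {x : ℝ | ((Finset.Icc 1 n).filter fun i => x < X i ω).card < k}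

/-- `|Σ_{i=1}^l Y_i - (l/n) Σ_{i=1}^n Y_i|` -/
def cusumAt (n : ℕ) (Y : ℕ → ℝ) (l : ℕ) : ℝ :=
  |∑ i ∈ Finset.Icc 1 l, Y i - ((l : ℝ) / n) * ∑ i ∈ Finset.Icc 1 n, Y i|

/-- The cusum statistic `T_n(φ)` with random threshold `X_(k)`. -/
def cusum (n k : ℕ) (X : ℕ → Ω → ℝ) (φ : ℝ → ℝ) (ω : Ω) : ℝ :=
  (Real.sqrt k)⁻¹ *
    ⨆ l ∈ Finset.Icc 1 n,
      cusumAt n (fun i => φ (Real.log (X i ω) - Real.log (orderStat n k X ω))) l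

/-- The cusum statistic with deterministic threshold `b(n/k)`. -/
def cusumDet (n k : ℕ) (X : ℕ → Ω → ℝ) (φ : ℝ → ℝ) (b : ℝ → ℝ) (ω : Ω) : ℝ :=
  (Real.sqrt k)⁻¹ *
    ⨆ l ∈ Finset.Icc 1 n,
      cusumAt n (fun i => φ (Real.log (X i ω) - Real.log (b ((n : ℝ) / k)))) l

/-- convergence in distribution (weak convergence of laws) of real random variables to
a real random variable `Z` defined on a possibly different probability space -/
def TendstoInDist {Ω' : Type*} [MeasureSpace Ω'] (Y : ℕ → Ω → ℝ) (Z : Ω' → ℝ) : Prop :=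
  ∀ f : ℝ → ℝ, Continuous f → (∃ C, ∀ x, |f x| ≤ C) →
    Tendsto (fun n : ℕ => ∫ ω, f (Y n ω)) atTop (nhds (∫ ω, f (Z ω)))

/-- convergence in distribution to a law `μ` on `ℝ` -/
def TendstoInLaw (Y : ℕ → Ω → ℝ) (μ : Measure ℝ) : Prop :=
  ∀ f : ℝ → ℝ, Continuous f → (∃ C, ∀ x, |f x| ≤ C) →
    Tendsto (fun n : ℕ => ∫ ω, f (Y n ω)) atTop (nhds (∫ x, f x ∂μ))

/-- bounded in probability (`O_P(1)`) -/
def BddInProb (Y : ℕ → Ω → ℝ) : Prop :=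
  ∀ ε : ℝ, 0 < ε → ∃ C : ℝ, ∀ᶠ n in atTop,
    ((ℙ : Measure Ω) {ω | C < |Y n ω|}).toReal < ε

/-- divergence to `+∞` in probability -/
def DivergesInProb (Y : ℕ → Ω → ℝ) : Prop :=
  ∀ C : ℝ, Tendsto (fun n : ℕ => ((ℙ : Measure Ω) {ω | Y n ω ≤ C}).toReal) atTop (nhds 0)

/-- standard Brownian motion on `[0, ∞)` -/
structure IsStdBrownianMotion {Ω' : Type*} [MeasureSpace Ω'] (B : ℝ → Ω' → ℝ) : Prop where
  isProb : IsProbabilityMeasure (ℙ : Measure Ω')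
  meas : ∀ t, Measurable (B t)
  start : ∀ᵐ ω ∂(ℙ : Measure Ω'), B 0 ω = 0
  gauss_incr : ∀ s t : ℝ, 0 ≤ s → s ≤ t →
    Measure.map (fun ω => B t ω - B s ω) (ℙ : Measure Ω')
      = gaussianReal 0 (Real.toNNReal (t - s))
  indep_incr : ∀ (n : ℕ) (ts : ℕ → ℝ), (∀ i, 0 ≤ ts i) → Monotone ts →
    iIndepFun (m := fun _ => Real.measurableSpace)
      (fun i : Fin n => fun ω => B (ts ((i : ℕ) + 1)) ω - B (ts (i : ℕ)) ω)
      (ℙ : Measure Ω')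

/-- `sup_{0 ≤ t ≤ 1} |B°(t)|` where `B°(t) = B(t) - t B(1)` is the Brownian bridge
associated with the Brownian motion `B` -/
def supAbsBrownianBridge {Ω' : Type*} [MeasureSpace Ω'] (B : ℝ → Ω' → ℝ) (ω : Ω') : ℝ :=
  ⨆ t : Icc (0 : ℝ) 1, |B (t : ℝ) ω - (t : ℝ) * B 1 ω|

/-- `A_i(ζ) = φ(log X_i - log b(n/k) + ζ/√k)` -/
def An (X : ℕ → Ω → ℝ) (b : ℝ → ℝ) (φ : ℝ → ℝ) (n k : ℕ) (ζ : ℝ) (i : ℕ) (ω : Ω) : ℝ :=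
  φ (Real.log (X i ω) - Real.log (b ((n : ℝ) / k)) + ζ / Real.sqrt k)

/-- the tail sequential process `M_n(t, ζ) = k^{-1/2} Σ_{i=1}^{[nt]} (A_i(ζ) - E A_1(ζ))` -/
def Mn (X : ℕ → Ω → ℝ) (b : ℝ → ℝ) (φ : ℝ → ℝ) (n k : ℕ) (t ζ : ℝ) (ω : Ω) : ℝ :=
  (Real.sqrt k)⁻¹ * ∑ i ∈ Finset.Icc 1 ⌊(n : ℝ) * t⌋₊,
    (An X b φ n k ζ i ω - ∫ ω', An X b φ n k ζ 1 ω')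

/-- residual `ξ̂_i = X_i - Σ_{j=1}^p φ̂_j X_{i-j}` of an AR(p) fit -/
def residual (p : ℕ) (X : ℤ → Ω → ℝ) (φh : Ω → Fin p → ℝ) (i : ℕ) (ω : Ω) : ℝ :=
  X i ω - ∑ j : Fin p, φh ω j * X ((i : ℤ) - ((j : ℕ) + 1)) ω

/-- absolute residual `Ẑ_i = |ξ̂_i|` -/
def Zhat (p : ℕ) (X : ℤ → Ω → ℝ) (φh : Ω → Fin p → ℝ) (i : ℕ) (ω : Ω) : ℝ :=
  |residual p X φh i ω|

/-- stationarity of the restriction of `Y` to the segment of indices `[a, b]` -/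
def SegStationary (a b : ℕ) (Y : ℕ → Ω → ℝ) : Prop :=
  ∀ (m : ℕ) (s : Fin m → ℕ) (j : ℕ), (∀ q, a ≤ s q ∧ s q + j ≤ b) →
    Measure.map (fun ω => fun q : Fin m => Y (s q + j) ω) (ℙ : Measure Ω)
      = Measure.map (fun ω => fun q : Fin m => Y (s q) ω) (ℙ : Measure Ω)

/-- the row-wise mixing coefficient
`β_n(l) = sup_m sup {|P(A∩B) - P(A)P(B)| : A ∈ σ(Y_i : m+l+1 ≤ i ≤ n), B ∈ σ(Y_1,…,Y_m)}` -/
def betaMixRow (n : ℕ) (Y : ℕ → Ω → ℝ) (lag : ℕ) : ℝ :=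
  ⨆ m : ℕ, ⨆ As : Subtype (MeasurableSet : Set (Fin (n - (m + lag)) → ℝ) → Prop),
    ⨆ Bs : Subtype (MeasurableSet : Set (Fin m → ℝ) → Prop),
      |((ℙ : Measure Ω)
          (((fun ω => fun i : Fin (n - (m + lag)) => Y (m + lag + 1 + (i : ℕ)) ω) ⁻¹' As.1)
            ∩ ((fun ω => fun i : Fin m => Y ((i : ℕ) + 1) ω) ⁻¹' Bs.1))).toReal
        - ((ℙ : Measure Ω)
            ((fun ω => fun i : Fin (n - (m + lag)) => Y (m + lag + 1 + (i : ℕ)) ω) ⁻¹' As.1)).toReal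
          * ((ℙ : Measure Ω)
            ((fun ω => fun i : Fin m => Y ((i : ℕ) + 1) ω) ⁻¹' Bs.1)).toReal|

/-! ### Decoupling of blocks under β-mixing -/

section Mixing

theorem integral_le_integral_add_of_forall_abs_measure_sub_le {S : Type*} [MeasurableSpace S]
    (P Q : Measure S) [IsProbabilityMeasure P] [IsProbabilityMeasure Q] {β C : ℝ}
    (h : ∀ s, MeasurableSet s → |(P s).toReal - (Q s).toReal| ≤ β)
    {f : S → ℝ} (hf : Measurable f) (h0 : ∀ x, 0 ≤ f x) (hC : 0 ≤ C) (h1 : ∀ x, f x ≤ C) :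
    ∫ x, f x ∂P ≤ ∫ x, f x ∂Q + C * β := by
  have hint : ∀ (R : Measure S) [IsProbabilityMeasure R], Integrable f R := fun R _ =>
    Integrable.of_bound hf.aestronglyMeasurable C
      (Eventually.of_forall fun x => by rw [Real.norm_eq_abs, abs_of_nonneg (h0 x)]; exact h1 x)
  have hmono : ∀ (R : Measure S) [IsProbabilityMeasure R],
      IntegrableOn (fun t : ℝ => R.real {a | t ≤ f a}) (Ioc 0 C) := by
    intro R _
    have : Antitone fun t : ℝ => R.real {a | t ≤ f a} := fun s t hst =>
      measureReal_mono fun a (ha : t ≤ f a) => hst.trans ha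
    exact (this.antitoneOn _).integrableOn_isCompact isCompact_Icc |>.mono_set Ioc_subset_Icc_self
  rw [(hint P).integral_eq_integral_Ioc_meas_le (Eventually.of_forall h0) (Eventually.of_forall h1),
    (hint Q).integral_eq_integral_Ioc_meas_le (Eventually.of_forall h0) (Eventually.of_forall h1)]
  have hconst : ∫ _ in Ioc 0 C, β = C * β := by simp [hC]
  rw [← hconst, ← integral_add (hmono Q) (integrable_const _)]
  refine integral_mono (hmono P) ((hmono Q).add (integrable_const _)) fun t => ?_
  have := (abs_le.1 (h {a | t ≤ f a} (measurableSet_le measurable_const hf))).2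
  simp only [Measure.real]
  linarith

theorem abs_toReal_sub_toReal_le_one {S : Type*} [MeasurableSpace S]
    (P Q : Measure S) [IsProbabilityMeasure P] [IsProbabilityMeasure Q] (s : Set S) :
    |(P s).toReal - (Q s).toReal| ≤ 1 := by
  have h1 : P.real s ≤ 1 := measureReal_le_one
  have h2 : Q.real s ≤ 1 := measureReal_le_one
  have h3 : 0 ≤ P.real s := measureReal_nonneg
  have h4 : 0 ≤ Q.real s := measureReal_nonneg
  simp only [Measure.real] at *
  rw [abs_le]; constructor <;> linarith

theorem betaMix_nonneg (X : ℕ → Ω → ℝ) (lag : ℕ) : 0 ≤ betaMix X lag :=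
  Real.iSup_nonneg fun _ => Real.iSup_nonneg fun _ => abs_nonneg _

variable [IsProbabilityMeasure (ℙ : Measure Ω)]

theorem abs_sub_le_betaMix {X : ℕ → Ω → ℝ} (hX : ∀ i, Measurable (X i)) (lag m : ℕ)
    (s : Set ((Fin m → ℝ) × (ℕ → ℝ))) (hs : MeasurableSet s) :
    |((Measure.map
        (fun ω => ((fun i : Fin m => X ((i : ℕ) + 1) ω, fun i : ℕ => X (m + lag + 1 + i) ω)))
        (ℙ : Measure Ω)) s).toReal
      - (((Measure.map (fun ω => fun i : Fin m => X ((i : ℕ) + 1) ω) (ℙ : Measure Ω)).prod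
          (Measure.map (fun ω => fun i : ℕ => X (m + lag + 1 + i) ω) (ℙ : Measure Ω))) s).toReal|
      ≤ betaMix X lag := by
  have hp : ∀ m, Measurable fun ω => fun i : Fin m => X ((i : ℕ) + 1) ω :=
    fun m => measurable_pi_lambda _ fun i => hX _
  have hq : ∀ m, Measurable fun ω => fun i : ℕ => X (m + lag + 1 + i) ω :=
    fun m => measurable_pi_lambda _ fun i => hX _
  have h1 := fun m => Measure.isProbabilityMeasure_map (μ := (ℙ : Measure Ω)) (hp m).aemeasurable
  have h2 := fun m => Measure.isProbabilityMeasure_map (μ := (ℙ : Measure Ω)) (hq m).aemeasurable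
  have h3 := fun m => Measure.isProbabilityMeasure_map (μ := (ℙ : Measure Ω))
    ((hp m).prodMk (hq m)).aemeasurable
  refine le_ciSup_of_le ⟨1, ?_⟩ m (le_ciSup_of_le ⟨1, ?_⟩ (⟨s, hs⟩ : Subtype _) le_rfl)
  · rintro _ ⟨m, rfl⟩
    have := h1 m
    have := h2 m
    have := h3 m
    exact Real.iSup_le (fun s => abs_toReal_sub_toReal_le_one _ _ _) zero_le_one
  · rintro _ ⟨s, rfl⟩
    have := h1 m
    have := h2 m
    have := h3 m
    exact abs_toReal_sub_toReal_le_one _ _ _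

theorem integral_mul_le_add_betaMix {X : ℕ → Ω → ℝ} (hX : ∀ i, Measurable (X i)) (lag m : ℕ)
    {F : (Fin m → ℝ) → ℝ} {H : (ℕ → ℝ) → ℝ} (hF : Measurable F) (hH : Measurable H)
    {C D : ℝ} (hF0 : ∀ x, 0 ≤ F x) (hFC : ∀ x, F x ≤ C) (hH0 : ∀ x, 0 ≤ H x)
    (hHD : ∀ x, H x ≤ D) :
    ∫ ω, F (fun i => X ((i : ℕ) + 1) ω) * H (fun i => X (m + lag + 1 + i) ω)
      ≤ (∫ ω, F (fun i => X ((i : ℕ) + 1) ω)) * (∫ ω, H (fun i => X (m + lag + 1 + i) ω))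
        + C * D * betaMix X lag := by
  have hp : Measurable fun ω => fun i : Fin m => X ((i : ℕ) + 1) ω :=
    measurable_pi_lambda _ fun i => hX _
  have hq : Measurable fun ω => fun i : ℕ => X (m + lag + 1 + i) ω :=
    measurable_pi_lambda _ fun i => hX _
  have h1 := Measure.isProbabilityMeasure_map (μ := (ℙ : Measure Ω)) hp.aemeasurable
  have h2 := Measure.isProbabilityMeasure_map (μ := (ℙ : Measure Ω)) hq.aemeasurable
  have h3 := Measure.isProbabilityMeasure_map (μ := (ℙ : Measure Ω)) (hp.prodMk hq).aemeasurable
  have hC : 0 ≤ C := (hF0 0).trans (hFC 0)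
  have hD : 0 ≤ D := (hH0 0).trans (hHD 0)
  have hmeas : Measurable fun z : (Fin m → ℝ) × (ℕ → ℝ) => F z.1 * H z.2 :=
    (hF.comp measurable_fst).mul (hH.comp measurable_snd)
  have key := integral_le_integral_add_of_forall_abs_measure_sub_le _ _
    (abs_sub_le_betaMix hX lag m) hmeas (fun z => mul_nonneg (hF0 _) (hH0 _)) (mul_nonneg hC hD)
    (fun z => mul_le_mul (hFC _) (hHD _) (hH0 _) hC)
  rwa [integral_prod_mul, integral_map (hp.prodMk hq).aemeasurable hmeas.aestronglyMeasurable,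
    integral_map hp.aemeasurable hF.aestronglyMeasurable,
    integral_map hq.aemeasurable hH.aestronglyMeasurable] at key

/-- Extension by zero of a finite sequence. -/
def extendZero (p : ℕ) (x : Fin p → ℝ) (i : ℕ) : ℝ := if h : i < p then x ⟨i, h⟩ else 0

theorem measurable_extendZero (p : ℕ) : Measurable (extendZero p) := by
  refine measurable_pi_lambda _ fun i => ?_
  by_cases h : i < p
  · simpa [extendZero, h] using measurable_pi_apply _
  · simp [extendZero, h]

theorem min_mul_le_min_mul {a b M : ℝ} (hM : 0 ≤ M) (hb : 1 ≤ b) :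
    min (a * b) M ≤ min a M * b := by
  rcases le_total a M with h | h
  · rw [min_eq_left h]; exact min_le_left _ _
  · rw [min_eq_right h]; exact (min_le_right _ _).trans (le_mul_of_one_le_right hM hb)

/-- Sum of `ψ (X_i)` over the `r` consecutive indices following `s`. -/
def blockSum (ψ : ℝ → ℝ) (r s : ℕ) (x : ℕ → ℝ) : ℝ := ∑ i ∈ Finset.range r, ψ (x (s + i))

theorem measurable_blockSum {ψ : ℝ → ℝ} (hψ : Measurable ψ) (r s : ℕ) :
    Measurable (blockSum ψ r s) :=
  Finset.measurable_sum _ fun _ _ => hψ.comp (measurable_pi_apply _)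

theorem integral_min_exp_sum_blockSum_le {X : ℕ → Ω → ℝ} (hX : ∀ i, Measurable (X i))
    {ψ : ℝ → ℝ} (hψ : Measurable ψ) (hψ0 : ∀ x, 0 ≤ ψ x) {b t μ M : ℝ} {r : ℕ}
    (hψb : ∀ x, ψ x ≤ b) (ht : 0 ≤ t) (hb : t * (r * b) ≤ 1)
    (hμ : ∀ i, ∫ ω, ψ (X i ω) = μ) (hM : 1 ≤ M) (o m : ℕ) :
    ∫ ω, min (Real.exp (t * ∑ j ∈ Finset.range m,
        blockSum ψ r (o + 2 * r * j) (fun i => X (i + 1) ω))) M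
      ≤ (1 + 2 * t * (r * μ)) ^ m * (1 + 3 * M * m * betaMix X r) := by
  set β := betaMix X r with hβ
  have hβ0 : 0 ≤ β := betaMix_nonneg X r
  have hμ0 : 0 ≤ μ := by rw [← hμ 0]; exact integral_nonneg fun _ => hψ0 _
  set a := 1 + 2 * t * (r * μ) with ha
  have ha1 : 1 ≤ a := by rw [ha]; have : 0 ≤ 2 * t * (r * μ) := by positivity
                         linarith
  have hBm : ∀ s, Measurable fun ω => blockSum ψ r s (fun i => X (i + 1) ω) := fun s =>
    (measurable_blockSum hψ r s).comp (measurable_pi_lambda _ fun i => hX _)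
  have hB0 : ∀ s x, 0 ≤ blockSum ψ r s x := fun s x => Finset.sum_nonneg fun _ _ => hψ0 _
  have hBb : ∀ s x, t * blockSum ψ r s x ≤ 1 := fun s x => by
    refine (mul_le_mul_of_nonneg_left ?_ ht).trans hb
    simpa [blockSum] using Finset.sum_le_card_nsmul (Finset.range r) (fun i => ψ (x (s + i))) b
      fun _ _ => hψb _
  have hψint : ∀ i, Integrable fun ω => ψ (X i ω) := fun i =>
    Integrable.of_bound (hψ.comp (hX i)).aestronglyMeasurable b
      (Eventually.of_forall fun x => by
        rw [Real.norm_eq_abs, abs_of_nonneg (hψ0 _)]; exact hψb _)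
  have hexp : ∀ x : ℝ, 0 ≤ x → x ≤ 1 → Real.exp x ≤ 1 + 2 * x := fun x h0 h1 => by
    have := Real.abs_exp_sub_one_le (x := x) (by rw [abs_of_nonneg h0]; exact h1)
    rw [abs_of_nonneg h0] at this
    linarith [le_abs_self (Real.exp x - 1)]
  have hexp3 : ∀ s x, Real.exp (t * blockSum ψ r s x) ≤ 3 := fun s x => by
    linarith [hexp _ (mul_nonneg ht (hB0 s x)) (hBb s x), hBb s x]
  have hWint : ∀ s, ∫ ω, Real.exp (t * blockSum ψ r s (fun i => X (i + 1) ω)) ≤ a := by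
    intro s
    have hint : Integrable fun ω => blockSum ψ r s (fun i => X (i + 1) ω) :=
      integrable_finsetSum _ fun i _ => hψint _
    have hI : ∫ ω, blockSum ψ r s (fun i => X (i + 1) ω) = r * μ := by
      simp only [blockSum]
      rw [integral_finsetSum _ fun i _ => hψint _]
      simp [hμ]
    calc ∫ ω, Real.exp (t * blockSum ψ r s (fun i => X (i + 1) ω))
        ≤ ∫ ω, (1 + 2 * t * blockSum ψ r s (fun i => X (i + 1) ω)) := by
          refine integral_mono (Integrable.of_bound
            ((hBm s).const_mul t).exp.aestronglyMeasurable 3 (Eventually.of_forall fun ω => ?_))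
            ((integrable_const _).add (hint.const_mul _)) fun ω => ?_
          · rw [Real.norm_eq_abs, abs_of_nonneg (Real.exp_pos _).le]; exact hexp3 _ _
          · have := hexp _ (mul_nonneg ht (hB0 s fun i => X (i + 1) ω)) (hBb _ _)
            simp only; linarith
      _ = a := by
          rw [integral_add (integrable_const _) (hint.const_mul _), integral_const_mul, hI]
          simp [ha]
  have hmin : ∀ j, Measurable fun x : ℕ → ℝ => min (Real.exp (t * ∑ i ∈ Finset.range j,
      blockSum ψ r (o + 2 * r * i) x)) M := fun j =>
    ((Finset.measurable_sum _ fun i _ => measurable_blockSum hψ r _).const_mul t).exp.min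
      measurable_const
  have hmin0 : ∀ j (x : ℕ → ℝ), 0 ≤ min (Real.exp (t * ∑ i ∈ Finset.range j,
      blockSum ψ r (o + 2 * r * i) x)) M := fun j x =>
    le_min (Real.exp_pos _).le (by linarith)
  induction m with
  | zero => simp [hM]
  | succ j ih =>
    set V : Ω → ℝ := fun ω => min (Real.exp (t * ∑ i ∈ Finset.range j,
      blockSum ψ r (o + 2 * r * i) (fun i => X (i + 1) ω))) M with hV
    set W : Ω → ℝ := fun ω =>
      Real.exp (t * blockSum ψ r (o + 2 * r * j) (fun i => X (i + 1) ω)) with hW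
    have hXm : Measurable fun ω => fun i => X (i + 1) ω := measurable_pi_lambda _ fun i => hX _
    have hVm : Measurable V := (hmin j).comp hXm
    have hWm : Measurable W := ((hBm _).const_mul t).exp
    have hV0 : ∀ ω, 0 ≤ V ω := fun ω => hmin0 _ _
    have hVM : ∀ ω, V ω ≤ M := fun ω => min_le_right _ _
    have hVI : 0 ≤ ∫ ω, V ω := integral_nonneg hV0
    have step : ∫ ω, V ω * W ω ≤ (∫ ω, V ω) * (∫ ω, W ω) + M * 3 * β := by
      rcases Nat.eq_zero_or_pos j with rfl | hj
      · have : V = fun _ => 1 := by funext ω; simp [hV, hM]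
        rw [this]
        have : 0 ≤ M * 3 * β := by positivity
        simpa using this
      · set p := o + 2 * r * (j - 1) + r with hp
        have hpe : p + r = o + 2 * r * j := by
          obtain ⟨q, rfl⟩ : ∃ q, j = q + 1 := ⟨j - 1, by omega⟩
          simp only [hp, Nat.add_sub_cancel]; ring
        have := integral_mul_le_add_betaMix hX r p
          (F := fun x => min (Real.exp (t * ∑ i ∈ Finset.range j,
            blockSum ψ r (o + 2 * r * i) (extendZero p x))) M)
          (H := fun y => Real.exp (t * blockSum ψ r 0 y))
          ((hmin j).comp (measurable_extendZero p))
          ((measurable_blockSum hψ r 0).const_mul t).exp (fun x => hmin0 _ _)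
          (fun x => min_le_right _ M) (fun y => (Real.exp_pos _).le) (fun y => hexp3 0 y)
        have e1 : ∀ ω, min (Real.exp (t * ∑ i ∈ Finset.range j, blockSum ψ r (o + 2 * r * i)
            (extendZero p fun i => X ((i : ℕ) + 1) ω))) M = V ω := by
          intro ω
          simp only [hV]
          congr 3
          refine Finset.sum_congr rfl fun i hi => Finset.sum_congr rfl fun s hs => ?_
          have hlt : o + 2 * r * i + s < p := by
            have h1 := Finset.mem_range.1 hi
            have h2 := Finset.mem_range.1 hs
            have h3 : 2 * r * i ≤ 2 * r * (j - 1) := Nat.mul_le_mul_left _ (by omega)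
            omega
          simp [extendZero, hlt]
        have e2 : ∀ ω, Real.exp (t * blockSum ψ r 0 (fun i => X (p + r + 1 + i) ω)) = W ω := by
          intro ω
          simp only [hW, blockSum, hpe]
          congr 2
          refine Finset.sum_congr rfl fun s _ => ?_
          congr 2; ring
        simpa only [e1, e2] using this
    calc ∫ ω, min (Real.exp (t * ∑ j ∈ Finset.range (j + 1),
          blockSum ψ r (o + 2 * r * j) (fun i => X (i + 1) ω))) M
        ≤ ∫ ω, V ω * W ω := by
          refine integral_mono (Integrable.of_bound
            ((hmin _).comp hXm).aestronglyMeasurable M (Eventually.of_forall fun ω => ?_))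
            (Integrable.of_bound (hVm.mul hWm).aestronglyMeasurable (M * 3)
              (Eventually.of_forall fun ω => ?_)) fun ω => ?_
          · rw [Real.norm_eq_abs, abs_of_nonneg (hmin0 _ _)]; exact min_le_right _ _
          · rw [Real.norm_eq_abs, abs_of_nonneg (mul_nonneg (hV0 _) (Real.exp_pos _).le)]
            exact mul_le_mul (hVM _) (hexp3 _ _) (Real.exp_pos _).le (by linarith)
          · simp only [Finset.sum_range_succ, mul_add, Real.exp_add]
            refine min_mul_le_min_mul (by linarith) (Real.one_le_exp (mul_nonneg ht (hB0 _ _)))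
      _ ≤ (∫ ω, V ω) * a + M * 3 * β := by
          linarith [mul_le_mul_of_nonneg_left (hWint (o + 2 * r * j)) hVI]
      _ ≤ a ^ j * (1 + 3 * M * j * β) * a + a ^ (j + 1) * (3 * M * β) := by
          have h1 := one_le_pow₀ ha1 (n := j + 1)
          have h2 : 0 ≤ 3 * M * β := by positivity
          nlinarith [mul_le_mul_of_nonneg_right ih (by linarith : (0 : ℝ) ≤ a)]
      _ = _ := by push_cast; ring

theorem measure_lt_sum_blockSum_le {X : ℕ → Ω → ℝ} (hX : ∀ i, Measurable (X i))
    {ψ : ℝ → ℝ} (hψ : Measurable ψ) (hψ0 : ∀ x, 0 ≤ ψ x) {b t μ ε : ℝ} {r : ℕ}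
    (hψb : ∀ x, ψ x ≤ b) (ht : 0 ≤ t) (hε : 0 ≤ ε) (hb : t * (r * b) ≤ 1)
    (hμ : ∀ i, ∫ ω, ψ (X i ω) = μ) (o m : ℕ) :
    (ℙ : Measure Ω).real {ω | ε < ∑ j ∈ Finset.range m,
        blockSum ψ r (o + 2 * r * j) (fun i => X (i + 1) ω)}
      ≤ Real.exp (2 * t * (m * r * μ)) * (Real.exp (-(t * ε)) + 3 * m * betaMix X r) := by
  set M := Real.exp (t * ε) with hM
  have hMpos : 0 < M := Real.exp_pos _
  have hμ0 : 0 ≤ μ := by rw [← hμ 0]; exact integral_nonneg fun _ => hψ0 _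
  have h1 := integral_min_exp_sum_blockSum_le hX hψ hψ0 hψb ht hb hμ
    (Real.one_le_exp (mul_nonneg ht hε)) o m
  have hXm : Measurable fun ω => fun i => X (i + 1) ω := measurable_pi_lambda _ fun i => hX _
  set f : Ω → ℝ := fun ω => min (Real.exp (t * ∑ j ∈ Finset.range m,
        blockSum ψ r (o + 2 * r * j) (fun i => X (i + 1) ω))) M with hf
  have hf0 : ∀ ω, 0 ≤ f ω := fun ω => le_min (Real.exp_pos _).le hMpos.le
  have hfm : Measurable f := (((Finset.measurable_sum _ fun i _ =>
    (measurable_blockSum hψ r _).comp hXm).const_mul t).exp.min measurable_const)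
  have h2 := mul_meas_ge_le_integral_of_nonneg (Eventually.of_forall hf0) (Integrable.of_bound
    (μ := (ℙ : Measure Ω)) hfm.aestronglyMeasurable M (Eventually.of_forall fun ω => by
      rw [Real.norm_eq_abs, abs_of_nonneg (hf0 _)]; exact min_le_right _ _)) M
  have h3 : (ℙ : Measure Ω).real {ω | ε < ∑ j ∈ Finset.range m,
        blockSum ψ r (o + 2 * r * j) (fun i => X (i + 1) ω)} ≤ (ℙ : Measure Ω).real {ω | M ≤ f ω} :=
    measureReal_mono fun ω (hω : ε < _) => le_min
      (Real.exp_le_exp.2 (mul_le_mul_of_nonneg_left hω.le ht)) le_rfl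
  have h4 : (1 + 2 * t * (r * μ)) ^ m ≤ Real.exp (2 * t * (m * r * μ)) := by
    have : 0 ≤ 2 * t * (r * μ) := by positivity
    calc (1 + 2 * t * (r * μ)) ^ m ≤ Real.exp (2 * t * (r * μ)) ^ m :=
          pow_le_pow_left₀ (by linarith) (by linarith [Real.add_one_le_exp (2 * t * (r * μ))]) m
      _ = _ := by rw [← Real.exp_nat_mul]; congr 1; ring
  have hβ0 : 0 ≤ betaMix X r := betaMix_nonneg X r
  have h5 : M * (ℙ : Measure Ω).real {ω | ε < ∑ j ∈ Finset.range m,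
        blockSum ψ r (o + 2 * r * j) (fun i => X (i + 1) ω)}
      ≤ Real.exp (2 * t * (m * r * μ)) * (1 + 3 * M * m * betaMix X r) :=
    (mul_le_mul_of_nonneg_left h3 hMpos.le).trans (h2.trans (h1.trans
      (mul_le_mul_of_nonneg_right h4 (by positivity))))
  rw [← mul_le_mul_iff_right₀ hMpos]
  refine h5.trans (le_of_eq ?_)
  rw [Real.exp_neg, ← hM]
  field_simp

theorem sum_Icc_le_sum_blockSum (y : ℕ → ℝ) (hy : ∀ i, 0 ≤ y i) {n r m : ℕ} (h : n ≤ 2 * r * m) :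
    ∑ i ∈ Finset.Icc 1 n, y i ≤
      ∑ j ∈ Finset.range m, blockSum id r (0 + 2 * r * j) (fun i => y (i + 1))
      + ∑ j ∈ Finset.range m, blockSum id r (r + 2 * r * j) (fun i => y (i + 1)) := by
  have h1 : ∀ m, ∑ i ∈ Finset.range (2 * r * m), y (i + 1)
      = ∑ j ∈ Finset.range m, blockSum id r (0 + 2 * r * j) (fun i => y (i + 1))
      + ∑ j ∈ Finset.range m, blockSum id r (r + 2 * r * j) (fun i => y (i + 1)) := by
    intro m
    induction m with
    | zero => simp
    | succ m ih =>
      rw [show 2 * r * (m + 1) = 2 * r * m + r + r by ring, Finset.sum_range_add,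
        Finset.sum_range_add, ih, Finset.sum_range_succ, Finset.sum_range_succ]
      simp only [blockSum, id, zero_add]
      rw [show 2 * r * m + r = r + 2 * r * m by ring]
      ring
  rw [← h1 m]
  have h2 : ∑ i ∈ Finset.Icc 1 n, y i = ∑ i ∈ Finset.range n, y (i + 1) := by
    rw [Finset.range_eq_Ico, Finset.sum_Ico_add' y 0 n 1]; rfl
  rw [h2]
  exact Finset.sum_le_sum_of_subset_of_nonneg (Finset.range_mono h) fun i _ _ => hy _

theorem measure_lt_sum_Icc_le {X : ℕ → Ω → ℝ} (hX : ∀ i, Measurable (X i))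
    {ψ : ℝ → ℝ} (hψ : Measurable ψ) (hψ0 : ∀ x, 0 ≤ ψ x) {b t μ ε : ℝ} {n r : ℕ}
    (hψb : ∀ x, ψ x ≤ b) (ht : 0 ≤ t) (hε : 0 ≤ ε) (hb : t * (r * b) ≤ 1)
    (hμ : ∀ i, ∫ ω, ψ (X i ω) = μ) (hr : 0 < r) (hrn : r ≤ n) (hμε : 24 * (n * μ) ≤ ε) :
    (ℙ : Measure Ω).real {ω | ε < ∑ i ∈ Finset.Icc 1 n, ψ (X i ω)}
      ≤ 2 * Real.exp (-(t * ε / 4)) + 12 * Real.exp (t * ε / 4) * (n / r * betaMix X r) := by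
  set m := n / (2 * r) + 1 with hm
  have hnm : n ≤ 2 * r * m := (Nat.lt_mul_div_succ n (by omega)).le
  have hmr : m * (2 * r) ≤ n + 2 * r := by
    have := Nat.div_mul_le_self n (2 * r)
    rw [hm, Nat.add_mul]; omega
  have hμ0 : 0 ≤ μ := by rw [← hμ 0]; exact integral_nonneg fun _ => hψ0 _
  have hβ0 : 0 ≤ betaMix X r := betaMix_nonneg X r
  have hr' : (0 : ℝ) < r := by exact_mod_cast hr
  have hrn' : (r : ℝ) ≤ n := by exact_mod_cast hrn
  have hmr' : (m : ℝ) * (2 * r) ≤ n + 2 * r := by exact_mod_cast hmr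
  have hm2 : (m : ℝ) ≤ 2 * (n / r) := by
    rw [mul_div_assoc', le_div_iff₀ hr']; linarith
  have hblock : ∀ o, (ℙ : Measure Ω).real {ω | ε / 2 < ∑ j ∈ Finset.range m,
      blockSum ψ r (o + 2 * r * j) (fun i => X (i + 1) ω)}
        ≤ Real.exp (-(t * ε / 4)) + 6 * Real.exp (t * ε / 4) * (n / r * betaMix X r) := by
    intro o
    refine (measure_lt_sum_blockSum_le hX hψ hψ0 hψb ht (by linarith : 0 ≤ ε / 2) hb hμ o m).trans ?_
    have h1 : Real.exp (2 * t * (m * r * μ)) ≤ Real.exp (t * ε / 4) := by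
      refine Real.exp_le_exp.2 ?_
      have : 2 * (m * r * μ) ≤ ε / 4 := by nlinarith
      nlinarith
    have h2 : Real.exp (t * ε / 4) * Real.exp (-(t * (ε / 2))) = Real.exp (-(t * ε / 4)) := by
      rw [← Real.exp_add]; congr 1; ring
    calc _ ≤ Real.exp (t * ε / 4) * (Real.exp (-(t * (ε / 2))) + 3 * m * betaMix X r) :=
          mul_le_mul_of_nonneg_right h1 (by positivity)
      _ ≤ Real.exp (t * ε / 4) *
          (Real.exp (-(t * (ε / 2))) + 3 * (2 * (n / r)) * betaMix X r) := by gcongr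
      _ = _ := by rw [mul_add, h2]; ring
  have hsub : {ω | ε < ∑ i ∈ Finset.Icc 1 n, ψ (X i ω)} ⊆
      {ω | ε / 2 < ∑ j ∈ Finset.range m, blockSum ψ r (0 + 2 * r * j) (fun i => X (i + 1) ω)} ∪
      {ω | ε / 2 < ∑ j ∈ Finset.range m,
        blockSum ψ r (r + 2 * r * j) (fun i => X (i + 1) ω)} := by
    intro ω hω
    by_contra hcon
    simp only [mem_union, mem_ofPred_eq, not_or, not_lt] at hcon hω
    have := sum_Icc_le_sum_blockSum (fun i => ψ (X i ω)) (fun i => hψ0 _) hnm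
    simp only [blockSum, id] at this hcon
    linarith
  refine (measureReal_mono hsub).trans ((measureReal_union_le _ _).trans ?_)
  linarith [hblock 0, hblock r]

end Mixing

/-! ### Uniform convergence along sequences for regularly varying functions -/

theorem tendsto_intervalIntegral_min_abs_sub {f : ℕ → ℝ → ℝ} {c : ℝ → ℝ}
    (hf : ∀ n, Measurable (f n)) (hc : Measurable c)
    (h : ∀ s, Tendsto (fun n => f n s) atTop (nhds (c s))) (a b : ℝ) :
    Tendsto (fun n => ∫ s in a..b, min |f n s - c s| 1) atTop (nhds 0) := by
  have := intervalIntegral.tendsto_integral_filter_of_dominated_convergence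
    (μ := volume) (a := a) (b := b) (l := atTop) (F := fun n s => min |f n s - c s| 1)
    (f := fun _ => (0 : ℝ)) (fun _ => 1)
    (Eventually.of_forall fun n =>
      ((measurable_norm.comp ((hf n).sub hc)).min measurable_const).aestronglyMeasurable)
    (Eventually.of_forall fun n => Eventually.of_forall fun s _ => by
      rw [Real.norm_eq_abs, abs_of_nonneg (le_min (abs_nonneg _) zero_le_one)]
      exact min_le_right _ _)
    intervalIntegrable_const
    (Eventually.of_forall fun s _ => by
      have h1 : Tendsto (fun n => |f n s - c s|) atTop (nhds 0) := by
        simpa using ((h s).sub_const (c s)).abs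
      simpa using h1.min (tendsto_const_nhds (x := (1 : ℝ))))
  simpa using this

theorem exists_mem_Icc_add_le {p q : ℝ → ℝ} (hp : Measurable p) (hq : Measurable q)
    (hp0 : ∀ s, 0 ≤ p s) (hp1 : ∀ s, p s ≤ 1) (hq0 : ∀ s, 0 ≤ q s) (hq1 : ∀ s, q s ≤ 1)
    {u : ℝ} (hu : |u| ≤ 1) :
    ∃ v ∈ Icc (0 : ℝ) 1, p v + q (v - u) ≤ (∫ s in (-1)..2, p s) + ∫ s in (-1)..2, q s := by
  have hpi : ∀ a b, IntervalIntegrable p volume a b := fun a b =>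
    (intervalIntegrable_const (c := (1 : ℝ))).mono_fun hp.aestronglyMeasurable
      (Eventually.of_forall fun s => by
        simpa [abs_of_nonneg (hp0 s)] using hp1 s)
  have hqi : ∀ a b, IntervalIntegrable q volume a b := fun a b =>
    (intervalIntegrable_const (c := (1 : ℝ))).mono_fun hq.aestronglyMeasurable
      (Eventually.of_forall fun s => by
        simpa [abs_of_nonneg (hq0 s)] using hq1 s)
  have hqm : Measurable fun s => q (s - u) := hq.comp (measurable_id.sub_const u)
  have hqi' : IntervalIntegrable (fun s => q (s - u)) volume 0 1 :=
    (intervalIntegrable_const (c := (1 : ℝ))).mono_fun hqm.aestronglyMeasurable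
      (Eventually.of_forall fun s => by
        simpa [abs_of_nonneg (hq0 (s - u))] using hq1 (s - u))
  have hint : IntegrableOn (fun s => p s + q (s - u)) (Ioc 0 1) :=
    (intervalIntegrable_iff_integrableOn_Ioc_of_le zero_le_one).1 ((hpi 0 1).add hqi')
  obtain ⟨v, hv, hle⟩ := exists_le_setAverage (μ := volume) (by simp) (by simp) hint
  refine ⟨v, Ioc_subset_Icc_self hv, hle.trans ?_⟩
  have hav : ⨍ s in Ioc (0 : ℝ) 1, (p s + q (s - u)) = ∫ s in (0 : ℝ)..1, (p s + q (s - u)) := by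
    rw [setAverage_eq, intervalIntegral.integral_of_le zero_le_one]; simp
  rw [hav, intervalIntegral.integral_add (hpi 0 1) hqi', intervalIntegral.integral_comp_sub_right]
  have hu' := abs_le.1 hu
  refine add_le_add
    (intervalIntegral.integral_mono_interval (by norm_num) (by norm_num) (by norm_num)
      (Eventually.of_forall hp0) (hpi _ _))
    (intervalIntegral.integral_mono_interval (by linarith) (by linarith) (by linarith)
      (Eventually.of_forall hq0) (hqi _ _))

/-- A sequential Egorov principle: two pointwise convergent sequences of measurable functions are
asymptotically close to their limit at suitable points whose difference is prescribed. -/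
theorem exists_seq_mem_Icc_tendsto {f f' : ℕ → ℝ → ℝ} {c : ℝ → ℝ}
    (hf : ∀ n, Measurable (f n)) (hf' : ∀ n, Measurable (f' n)) (hc : Continuous c)
    (h : ∀ s, Tendsto (fun n => f n s) atTop (nhds (c s)))
    (h' : ∀ s, Tendsto (fun n => f' n s) atTop (nhds (c s)))
    {u : ℕ → ℝ} (hu : Tendsto u atTop (nhds 0)) :
    ∃ v : ℕ → ℝ, (∀ n, v n ∈ Icc (0 : ℝ) 1) ∧
      Tendsto (fun n => f n (v n) - c (v n)) atTop (nhds 0) ∧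
      Tendsto (fun n => f' n (v n - u n) - c (v n)) atTop (nhds 0) := by
  set p : ℕ → ℝ → ℝ := fun n s => min |f n s - c s| 1 with hp
  set q : ℕ → ℝ → ℝ := fun n s => min |f' n s - c s| 1 with hq
  have hpm : ∀ n, Measurable (p n) := fun n =>
    (measurable_norm.comp ((hf n).sub hc.measurable)).min measurable_const
  have hqm : ∀ n, Measurable (q n) := fun n =>
    (measurable_norm.comp ((hf' n).sub hc.measurable)).min measurable_const
  have hp0 : ∀ n s, 0 ≤ p n s := fun n s => le_min (abs_nonneg _) zero_le_one
  have hq0 : ∀ n s, 0 ≤ q n s := fun n s => le_min (abs_nonneg _) zero_le_one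
  have hex : ∀ n, ∃ v ∈ Icc (0 : ℝ) 1, |u n| ≤ 1 →
      p n v + q n (v - u n) ≤ (∫ s in (-1)..2, p n s) + ∫ s in (-1)..2, q n s := by
    intro n
    by_cases hn : |u n| ≤ 1
    · obtain ⟨v, hv, hle⟩ := exists_mem_Icc_add_le (hpm n) (hqm n) (hp0 n)
        (fun s => min_le_right _ _) (hq0 n) (fun s => min_le_right _ _) hn
      exact ⟨v, hv, fun _ => hle⟩
    · exact ⟨0, by simp, fun h => absurd h hn⟩
  choose v hv hle using hex
  have hlim : Tendsto (fun n => (∫ s in (-1)..2, p n s) + ∫ s in (-1)..2, q n s) atTop (nhds 0) := by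
    simpa using (tendsto_intervalIntegral_min_abs_sub hf hc.measurable h (-1) 2).add
      (tendsto_intervalIntegral_min_abs_sub hf' hc.measurable h' (-1) 2)
  have hu1 : ∀ᶠ n in atTop, |u n| ≤ 1 := by
    have : Tendsto (fun n => |u n|) atTop (nhds 0) := by simpa using hu.abs
    exact (this.eventually (eventually_lt_nhds zero_lt_one)).mono fun n h => h.le
  have of_min : ∀ w : ℕ → ℝ, Tendsto (fun n => min |w n| 1) atTop (nhds 0) →
      Tendsto w atTop (nhds 0) := by
    intro w hw
    rw [tendsto_zero_iff_abs_tendsto_zero]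
    refine hw.congr' ?_
    filter_upwards [hw.eventually (eventually_lt_nhds zero_lt_one)] with n hn
    rcases min_lt_iff.1 hn with h | h
    · exact min_eq_left h.le
    · exact absurd h (lt_irrefl _)
  have h1 : Tendsto (fun n => f n (v n) - c (v n)) atTop (nhds 0) := by
    refine of_min _ (squeeze_zero' (Eventually.of_forall fun n => hp0 n (v n)) ?_ hlim)
    filter_upwards [hu1] with n hn
    linarith [hle n hn, hq0 n (v n - u n)]
  have h2 : Tendsto (fun n => f' n (v n - u n) - c (v n - u n)) atTop (nhds 0) := by
    refine of_min _ (squeeze_zero' (Eventually.of_forall fun n => hq0 n (v n - u n)) ?_ hlim)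
    filter_upwards [hu1] with n hn
    linarith [hle n hn, hp0 n (v n)]
  have h3 : Tendsto (fun n => c (v n - u n) - c (v n)) atTop (nhds 0) := by
    have huc := (isCompact_Icc (a := (-1 : ℝ)) (b := 2)).uniformContinuousOn_of_continuous
      hc.continuousOn
    rw [Metric.uniformContinuousOn_iff] at huc
    rw [Metric.tendsto_nhds]
    intro ε hε
    obtain ⟨δ, hδ, hd⟩ := huc ε hε
    have hu2 := (Metric.tendsto_nhds.1 hu) δ hδ
    filter_upwards [hu1, hu2] with n hn1 hn2
    have hv' := hv n
    have hn1' := abs_le.1 hn1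
    have := hd (v n - u n) ⟨by linarith [hv'.1], by linarith [hv'.2]⟩ (v n)
      ⟨by linarith [hv'.1], by linarith [hv'.2]⟩
      (by rw [Real.dist_eq] at hn2 ⊢; simpa using hn2)
    rw [Real.dist_eq] at this ⊢
    simpa using this
  exact ⟨v, hv, h1, by simpa using h2.add h3⟩

theorem tendsto_div_of_regularlyVarying_exp {G : ℝ → ℝ} (hG : Measurable G) (hG0 : ∀ x, 0 < G x)
    {γ : ℝ} (h : ∀ s, Tendsto (fun x => G (x + s) / G x) atTop (nhds (Real.exp (γ * s))))
    {x u : ℕ → ℝ} (hx : Tendsto x atTop atTop) (hu : Tendsto u atTop (nhds 0)) :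
    Tendsto (fun n => G (x n + u n) / G (x n)) atTop (nhds 1) := by
  have hy : Tendsto (fun n => x n + u n) atTop atTop := hx.atTop_add hu
  obtain ⟨v, hv, h1, h2⟩ := exists_seq_mem_Icc_tendsto
    (f := fun n s => G (x n + s) / G (x n)) (f' := fun n s => G (x n + u n + s) / G (x n + u n))
    (fun n => (hG.comp (measurable_const_add _)).div_const _)
    (fun n => (hG.comp (measurable_const_add _)).div_const _)
    (c := fun s => Real.exp (γ * s)) (by fun_prop) (fun s => (h s).comp hx)
    (fun s => (h s).comp hy) hu
  have hlow : ∀ n, Real.exp (-|γ|) ≤ Real.exp (γ * v n) := fun n => by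
    refine Real.exp_le_exp.2 ?_
    have h1 := neg_abs_le (γ * v n)
    rw [abs_mul, abs_of_nonneg (hv n).1] at h1
    nlinarith [(hv n).2, abs_nonneg γ]
  have hb : ∀ n, ‖(Real.exp (γ * v n))⁻¹‖ ≤ (Real.exp (-|γ|))⁻¹ := fun n => by
    rw [Real.norm_eq_abs, abs_of_pos (inv_pos.2 (Real.exp_pos _))]
    exact inv_anti₀ (Real.exp_pos _) (hlow n)
  have scale : ∀ w : ℕ → ℝ, Tendsto (fun n => w n - Real.exp (γ * v n)) atTop (nhds 0) →
      Tendsto (fun n => w n * (Real.exp (γ * v n))⁻¹) atTop (nhds 1) := by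
    intro w hw
    have := (hw.zero_mul_isBoundedUnder_le
      (isBoundedUnder_of ⟨_, hb⟩ : IsBoundedUnder (· ≤ ·) atTop
        (norm ∘ fun n => (Real.exp (γ * v n))⁻¹))).add_const 1
    rw [zero_add] at this
    refine this.congr fun n => ?_
    have := (Real.exp_pos (γ * v n)).ne'
    field_simp
    ring
  have h4 := (scale _ h1).div (scale _ h2) one_ne_zero
  rw [div_one] at h4
  refine h4.congr fun n => ?_
  have := (Real.exp_pos (γ * v n)).ne'
  have e1 := (hG0 (x n)).ne'
  have e2 := (hG0 (x n + u n)).ne'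
  have e3 := (hG0 (x n + v n)).ne'
  simp only [Pi.div_apply]
  rw [show x n + u n + (v n - u n) = x n + v n by ring]
  field_simp

/-- Local uniformity at the origin of the second order regular variation condition, in additive
coordinates. -/
theorem tendsto_secondOrder_exp {L G c : ℝ → ℝ} (hL : Measurable L) (hL0 : ∀ᶠ x in atTop, L x ≠ 0)
    (hG : Measurable G) (hG0 : ∀ x, 0 < G x) {γ : ℝ}
    (h : ∀ s, Tendsto (fun x => G (x + s) / G x) atTop (nhds (Real.exp (γ * s))))
    (hc : Continuous c)
    (hLG : ∀ s, Tendsto (fun x => (L (x + s) / L x - 1) / G x) atTop (nhds (c s)))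
    {x u : ℕ → ℝ} (hx : Tendsto x atTop atTop) (hu : Tendsto u atTop (nhds 0))
    (hGx : Tendsto (fun n => G (x n)) atTop (nhds 0)) :
    Tendsto (fun n => (L (x n + u n) / L (x n) - 1) / G (x n)) atTop (nhds 0) := by
  have hy : Tendsto (fun n => x n + u n) atTop atTop := hx.atTop_add hu
  have hratio := tendsto_div_of_regularlyVarying_exp hG hG0 h hx hu
  obtain ⟨v, hv, h1, h2⟩ := exists_seq_mem_Icc_tendsto
    (f := fun n s => (L (x n + s) / L (x n) - 1) / G (x n))
    (f' := fun n s => (L (x n + u n + s) / L (x n + u n) - 1) / G (x n + u n))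
    (fun n => (((hL.comp (measurable_const_add _)).div_const _).sub_const _).div_const _)
    (fun n => (((hL.comp (measurable_const_add _)).div_const _).sub_const _).div_const _)
    hc (fun s => (hLG s).comp hx) (fun s => (hLG s).comp hy) hu
  obtain ⟨B, hB⟩ := (isCompact_Icc (a := (0 : ℝ)) (b := 1)).exists_bound_of_continuousOn
    hc.continuousOn
  have hcb : IsBoundedUnder (· ≤ ·) atTop (norm ∘ fun n => c (v n)) :=
    isBoundedUnder_of ⟨B, fun n => hB _ (hv n)⟩
  set a : ℕ → ℝ := fun n => (L (x n + v n) / L (x n) - 1) / G (x n) with ha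
  set a' : ℕ → ℝ := fun n =>
    (L (x n + u n + (v n - u n)) / L (x n + u n) - 1) / G (x n + u n) with ha'
  set R : ℕ → ℝ := fun n => G (x n + u n) / G (x n) with hR
  have hGy : Tendsto (fun n => G (x n + u n)) atTop (nhds 0) := by
    have := hratio.mul hGx
    rw [one_mul] at this
    exact this.congr fun n => by
      have := (hG0 (x n)).ne'
      simp only [hR]
      field_simp
  have hnum : Tendsto (fun n => a n - R n * a' n) atTop (nhds 0) := by
    have t1 : Tendsto (fun n => (1 - R n) * c (v n)) atTop (nhds 0) :=
      Tendsto.zero_mul_isBoundedUnder_le (by simpa using hratio.const_sub 1) hcb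
    have := (h1.sub (hratio.mul h2)).add t1
    simp only [mul_zero, sub_zero, add_zero] at this
    exact this.congr fun n => by simp only [ha, ha', hR]; ring
  have hden : Tendsto (fun n => 1 + G (x n + u n) * a' n) atTop (nhds 1) := by
    have t1 : Tendsto (fun n => G (x n + u n) * c (v n)) atTop (nhds 0) :=
      hGy.zero_mul_isBoundedUnder_le hcb
    have := ((hGy.mul h2).add t1).const_add 1
    simp only [mul_zero, add_zero] at this
    exact this.congr fun n => by simp only [ha']; ring
  have hfin := hnum.div hden one_ne_zero
  rw [zero_div] at hfin
  refine hfin.congr' ?_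
  filter_upwards [hx.eventually hL0, hy.eventually hL0, hden.eventually_ne one_ne_zero]
    with n n1 n2 n3
  have e1 := (hG0 (x n)).ne'
  have e2 := (hG0 (x n + u n)).ne'
  simp only [ha, ha', hR, Pi.div_apply] at n3 ⊢
  rw [show x n + u n + (v n - u n) = x n + v n by ring] at n3 ⊢
  have e3 : 1 + G (x n + u n) * ((L (x n + v n) / L (x n + u n) - 1) / G (x n + u n))
      = L (x n + v n) / L (x n + u n) := by field_simp; ring
  have e4 : L (x n + v n) ≠ 0 := by
    intro h0; rw [e3, h0, zero_div] at n3; exact n3 rfl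
  simp only [e3]
  field_simp
  ring

theorem continuous_kappaFun_exp (K γ : ℝ) : Continuous fun s => kappaFun K γ (Real.exp s) := by
  have : ∀ s, kappaFun K γ (Real.exp s) = K * ∫ w in (0 : ℝ)..s, Real.exp (γ * w) := by
    intro s
    have h := intervalIntegral.integral_comp_mul_deriv'' (a := 0) (b := s) (f := Real.exp)
      (f' := Real.exp) (g := fun t => t ^ (γ - 1)) Real.continuous_exp.continuousOn
      (fun x _ => (Real.hasDerivAt_exp x).hasDerivWithinAt) Real.continuous_exp.continuousOn
      (fun t ht => (Real.continuousAt_rpow_const t _ (Or.inl (by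
        obtain ⟨w, _, rfl⟩ := ht; exact (Real.exp_pos w).ne'))).continuousWithinAt)
    rw [Real.exp_zero] at h
    rw [kappaFun, ← h]
    congr 1
    refine intervalIntegral.integral_congr fun w _ => ?_
    simp only [Function.comp]
    rw [← Real.exp_mul, ← Real.exp_add]
    congr 1; ring
  simp only [this]
  exact (intervalIntegral.continuous_primitive
    (fun a b => (by fun_prop : Continuous fun w => Real.exp (γ * w)).intervalIntegrable a b)
    0).const_mul K

/-! ### Tail estimates near the quantile -/

section Tail

variable {μ : Measure ℝ}

theorem ParetoTail.eventually_ne_zero {α : ℝ} {l : ℝ → ℝ} (hF : ParetoTail μ α l) :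
    ∀ᶠ x in atTop, l x ≠ 0 := by
  filter_upwards [(hF.1.2 2 two_pos).eventually_ne one_ne_zero] with x hx h0
  rw [h0, div_zero] at hx
  exact hx rfl

theorem ParetoTail.tailDF_exp {α : ℝ} {l : ℝ → ℝ} (hF : ParetoTail μ α l) (s : ℝ) :
    tailDF μ (Real.exp s) = Real.exp (-α * s) * l (Real.exp s) := by
  rw [hF.2 _ (Real.exp_pos s), ← Real.exp_mul]
  congr 2; ring

variable [IsProbabilityMeasure μ]

theorem tailDF_eq_one_sub_cdf (x : ℝ) : tailDF μ x = 1 - cdf μ x := by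
  rw [cdf_eq_real, ← probReal_compl_eq_one_sub measurableSet_Iic, compl_Iic]
  rfl

theorem tailDF_antitone : Antitone (tailDF μ) := fun x y h => by
  rw [tailDF_eq_one_sub_cdf, tailDF_eq_one_sub_cdf]
  linarith [monotone_cdf μ h]

theorem df_eq_cdf (x : ℝ) : df μ x = cdf μ x := by
  rw [cdf_eq_real]; rfl

theorem tailDF_quantileB_le {x : ℝ} (hx : 1 < x) : tailDF μ (quantileB μ x) ≤ x⁻¹ := by
  have hx1 : x⁻¹ < 1 := inv_lt_one_of_one_lt₀ hx
  have hx0 : 0 < x⁻¹ := inv_pos.2 (by linarith)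
  set s := {y : ℝ | 1 - x⁻¹ ≤ df μ y} with hs
  have hne : s.Nonempty := by
    obtain ⟨y, hy⟩ := ((tendsto_cdf_atTop μ).eventually
      (eventually_gt_nhds (by linarith : 1 - x⁻¹ < 1))).exists
    exact ⟨y, by rw [hs, mem_ofPred_eq, df_eq_cdf]; exact hy.le⟩
  have hgt : ∀ y, quantileB μ x < y → 1 - x⁻¹ ≤ cdf μ y := by
    intro y hy
    obtain ⟨z, hz, hzy⟩ := exists_lt_of_csInf_lt hne hy
    rw [hs, mem_ofPred_eq, df_eq_cdf] at hz
    exact hz.trans (monotone_cdf μ hzy.le)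
  have hlim : Tendsto (cdf μ) (nhdsWithin (quantileB μ x) (Ioi (quantileB μ x)))
      (nhds (cdf μ (quantileB μ x))) :=
    ((cdf μ).right_continuous _).mono Ioi_subset_Ici_self
  have := ge_of_tendsto hlim (eventually_nhdsWithin_of_forall hgt)
  rw [tailDF_eq_one_sub_cdf]
  linarith

theorem ParetoTail.tailDF_pos {α : ℝ} {l : ℝ → ℝ} (hF : ParetoTail μ α l) (x : ℝ) :
    0 < tailDF μ x := by
  obtain ⟨y, h1, h2, h3⟩ := (hF.eventually_ne_zero.and
    ((eventually_ge_atTop x).and (eventually_gt_atTop 0))).exists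
  have : tailDF μ y ≠ 0 := by
    rw [hF.2 y h3]; exact mul_ne_zero (Real.rpow_pos_of_pos h3 _).ne' h1
  exact (lt_of_le_of_ne ENNReal.toReal_nonneg this.symm).trans_le (tailDF_antitone h2)

theorem ParetoTail.tendsto_quantileB {α : ℝ} {l : ℝ → ℝ} (hF : ParetoTail μ α l) :
    Tendsto (quantileB μ) atTop atTop := by
  refine tendsto_atTop.2 fun y => ?_
  filter_upwards [tendsto_inv_atTop_zero.eventually (eventually_lt_nhds (hF.tailDF_pos y)),
    eventually_gt_atTop (0 : ℝ)] with x hx hx0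
  refine le_csInf ?_ fun z hz => ?_
  · have hx0' : 0 < x⁻¹ := inv_pos.2 hx0
    obtain ⟨z, hz⟩ := ((tendsto_cdf_atTop μ).eventually
      (eventually_gt_nhds (by linarith : 1 - x⁻¹ < 1))).exists
    exact ⟨z, by rw [mem_ofPred_eq, df_eq_cdf]; exact hz.le⟩
  · rw [mem_ofPred_eq, df_eq_cdf] at hz
    by_contra! hlt
    have := tailDF_antitone (μ := μ) hlt.le
    rw [tailDF_eq_one_sub_cdf z] at this
    linarith

theorem TailFraction.tendsto_sqrt {k : ℕ → ℕ} (hk : TailFraction k) :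
    Tendsto (fun n => Real.sqrt (k n)) atTop atTop :=
  Real.tendsto_sqrt_atTop.comp hk.1

theorem TailFraction.tendsto_div {k : ℕ → ℕ} (hk : TailFraction k) :
    Tendsto (fun n : ℕ => (n : ℝ) / k n) atTop atTop := by
  have hpos : ∀ᶠ n : ℕ in atTop, (k n : ℝ) / n ∈ Ioi (0 : ℝ) := by
    filter_upwards [hk.1.eventually_gt_atTop 0, eventually_gt_atTop 0] with n h1 h2
    exact div_pos h1 (by exact_mod_cast h2)
  have := (tendsto_nhdsWithin_iff.2 ⟨hk.2, hpos⟩).inv_tendsto_nhdsGT_zero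
  exact this.congr fun n => by simp

theorem ParetoTail.tendsto_log_quantileB {α : ℝ} {l : ℝ → ℝ} (hF : ParetoTail μ α l)
    {k : ℕ → ℕ} (hk : TailFraction k) :
    Tendsto (fun n : ℕ => Real.log (quantileB μ ((n : ℝ) / k n))) atTop atTop :=
  Real.tendsto_log_atTop.comp (hF.tendsto_quantileB.comp hk.tendsto_div)

theorem eventually_sqrt_mul_abs_slowlyVarying_le {α : ℝ} {l : ℝ → ℝ} (hF : ParetoTail μ α l)
    {k : ℕ → ℕ} (hk : TailFraction k) {g : ℝ → ℝ} {K γ A : ℝ}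
    (hA2 : CondA2 l g K γ A (quantileB μ) k) (K' : ℝ) {η : ℝ} (hη : 0 < η) :
    ∀ᶠ n in atTop, ∀ v : ℝ, |v| ≤ K' / Real.sqrt (k n) →
      Real.sqrt (k n) *
        |l (Real.exp (Real.log (quantileB μ ((n : ℝ) / k n)) + v)) /
          l (Real.exp (Real.log (quantileB μ ((n : ℝ) / k n)))) - 1| ≤ η := by
  set x : ℕ → ℝ := fun n => Real.log (quantileB μ ((n : ℝ) / k n)) with hxdef
  have hx : Tendsto x atTop atTop := hF.tendsto_log_quantileB hk
  have hb : Tendsto (fun n : ℕ => quantileB μ ((n : ℝ) / k n)) atTop atTop :=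
    hF.tendsto_quantileB.comp hk.tendsto_div
  obtain ⟨⟨-, hg0, ⟨hgm, hg⟩, hlg⟩, hA⟩ := hA2
  have hshift : ∀ (s y : ℝ), Real.exp s * Real.exp y = Real.exp (y + s) := fun s y => by
    rw [← Real.exp_add, add_comm]
  have hG : ∀ s, Tendsto (fun y => g (Real.exp (y + s)) / g (Real.exp y)) atTop
      (nhds (Real.exp (γ * s))) := fun s => by
    have := (hg _ (Real.exp_pos s)).comp Real.tendsto_exp_atTop
    rw [← Real.exp_mul, mul_comm] at this
    exact this.congr fun y => by simp only [Function.comp, hshift]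
  have hLG : ∀ s, Tendsto (fun y => (l (Real.exp (y + s)) / l (Real.exp y) - 1) / g (Real.exp y))
      atTop (nhds (kappaFun K γ (Real.exp s))) := fun s =>
    ((hlg _ (Real.exp_pos s)).comp Real.tendsto_exp_atTop).congr fun y => by
      simp only [Function.comp, hshift]
  have hwg : Tendsto (fun n => Real.sqrt (k n) * g (Real.exp (x n))) atTop (nhds A) := by
    refine hA.congr' ?_
    filter_upwards [hb.eventually_gt_atTop 0] with n hn
    simp only [hxdef, Real.exp_log hn]
  have hgx : Tendsto (fun n => g (Real.exp (x n))) atTop (nhds 0) := by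
    refine (hwg.div_atTop hk.tendsto_sqrt).congr' ?_
    filter_upwards [hk.tendsto_sqrt.eventually_gt_atTop 0] with n hn
    field_simp
  have hseq : ∀ u : ℕ → ℝ, Tendsto u atTop (nhds 0) →
      Tendsto (fun n => Real.sqrt (k n) * |l (Real.exp (x n + u n)) / l (Real.exp (x n)) - 1|)
        atTop (nhds 0) := by
    intro u hu
    have h1 := tendsto_secondOrder_exp (L := fun s => l (Real.exp s))
      (G := fun s => g (Real.exp s)) (hF.1.1.comp Real.measurable_exp)
      (Real.tendsto_exp_atTop.eventually hF.eventually_ne_zero) (hgm.comp Real.measurable_exp)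
      (fun _ => hg0 _) hG (continuous_kappaFun_exp K γ) hLG hx hu hgx
    have h2 := (hwg.mul h1).abs
    rw [mul_zero, abs_zero] at h2
    refine h2.congr fun n => ?_
    have := (hg0 (Real.exp (x n))).ne'
    rw [mul_assoc, mul_div_cancel₀ _ this, abs_mul, abs_of_nonneg (Real.sqrt_nonneg _)]
  classical
  set bad : ℕ → ℝ → Prop := fun n v => |v| ≤ K' / Real.sqrt (k n) ∧
    η < Real.sqrt (k n) * |l (Real.exp (x n + v)) / l (Real.exp (x n)) - 1| with hbad
  set u : ℕ → ℝ := fun n => if h : ∃ v, bad n v then h.choose else 0 with hu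
  have hu0 : Tendsto u atTop (nhds 0) := by
    have hlim : Tendsto (fun n => |K' / Real.sqrt (k n)|) atTop (nhds 0) := by
      simpa using (tendsto_const_nhds (x := K')).div_atTop hk.tendsto_sqrt |>.abs
    refine squeeze_zero_norm (fun n => ?_) hlim
    by_cases h : ∃ v, bad n v
    · simp only [hu, dif_pos h]
      exact h.choose_spec.1.trans (le_abs_self _)
    · simp [hu, dif_neg h]
  filter_upwards [(hseq u hu0).eventually (eventually_lt_nhds hη)] with n hn v hv
  by_contra! hlt
  have h : ∃ v, bad n v := ⟨v, hv, hlt⟩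
  have := h.choose_spec.2
  simp only [hu, dif_pos h] at hn
  linarith

theorem eventually_tailDF_exp_eq {α : ℝ} {l : ℝ → ℝ} (hF : ParetoTail μ α l)
    {k : ℕ → ℕ} (hk : TailFraction k) {g : ℝ → ℝ} {K γ A : ℝ}
    (hA2 : CondA2 l g K γ A (quantileB μ) k) (K' : ℝ) {η : ℝ} (hη : 0 < η) :
    ∀ᶠ n : ℕ in atTop, tailDF μ (Real.exp (Real.log (quantileB μ ((n : ℝ) / k n)))) ≤ (k n : ℝ) / n ∧
      ∀ v : ℝ, |v| ≤ K' / Real.sqrt (k n) → ∃ θ : ℝ, Real.sqrt (k n) * |θ| ≤ η ∧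
        tailDF μ (Real.exp (Real.log (quantileB μ ((n : ℝ) / k n)) + v)) =
          tailDF μ (Real.exp (Real.log (quantileB μ ((n : ℝ) / k n))))
            * (Real.exp (-α * v) * (1 + θ)) := by
  have hb : Tendsto (fun n : ℕ => quantileB μ ((n : ℝ) / k n)) atTop atTop :=
    hF.tendsto_quantileB.comp hk.tendsto_div
  filter_upwards [eventually_sqrt_mul_abs_slowlyVarying_le hF hk hA2 K' hη,
    hb.eventually_gt_atTop 0, hk.tendsto_div.eventually_gt_atTop 1,
    (Real.tendsto_exp_atTop.comp (hF.tendsto_log_quantileB hk)).eventually hF.eventually_ne_zero]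
    with n h1 h2 h3 h4
  refine ⟨?_, fun v hv => ⟨_, h1 v hv, ?_⟩⟩
  · rw [Real.exp_log h2, ← inv_div (n : ℝ)]
    exact tailDF_quantileB_le h3
  · simp only [Function.comp] at h4
    rw [hF.tailDF_exp, hF.tailDF_exp, mul_add, Real.exp_add]
    field_simp
    ring

theorem exp_sub_exp_le {a b : ℝ} : Real.exp b - Real.exp a ≤ Real.exp b * (b - a) := by
  have h := Real.add_one_le_exp (a - b)
  have h2 : Real.exp a = Real.exp b * Real.exp (a - b) := by rw [← Real.exp_add]; congr 1; ring
  rw [h2]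
  nlinarith [Real.exp_pos b]

theorem eventually_tailDF_increment_le {α : ℝ} (hα : 0 < α) {l : ℝ → ℝ} (hF : ParetoTail μ α l)
    {k : ℕ → ℕ} (hk : TailFraction k) {g : ℝ → ℝ} {K γ A : ℝ}
    (hA2 : CondA2 l g K γ A (quantileB μ) k) (K' : ℝ) {η : ℝ} (hη : 0 < η) :
    ∀ᶠ n : ℕ in atTop, ∀ s t : ℝ, -K' ≤ s → s ≤ t → t ≤ K' →
      (n : ℝ) / Real.sqrt (k n) *
        (tailDF μ (Real.exp (Real.log (quantileB μ ((n : ℝ) / k n)) - t / Real.sqrt (k n)))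
        - tailDF μ (Real.exp (Real.log (quantileB μ ((n : ℝ) / k n)) - s / Real.sqrt (k n))))
        ≤ 2 * α * (t - s) + η ∧
      (n : ℝ) / k n *
        tailDF μ (Real.exp (Real.log (quantileB μ ((n : ℝ) / k n)) - t / Real.sqrt (k n))) ≤ 4 := by
  have hexp : Tendsto (fun n => Real.exp (α * K' / Real.sqrt (k n))) atTop (nhds 1) := by
    have := (tendsto_const_nhds (x := α * K')).div_atTop hk.tendsto_sqrt
    simpa [Function.comp_def] using (Real.continuous_exp.tendsto 0).comp this
  filter_upwards [eventually_tailDF_exp_eq hF hk hA2 K' (by positivity : 0 < min (η / 4) 1),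
    hexp.eventually (eventually_lt_nhds one_lt_two), hk.tendsto_sqrt.eventually_ge_atTop 1,
    eventually_gt_atTop 0] with n ⟨h1, h2⟩ h3 h4 h5 s t hs hst ht
  set x := Real.log (quantileB μ ((n : ℝ) / k n)) with hx
  set w := Real.sqrt (k n) with hw
  set T := tailDF μ (Real.exp x) with hT
  have hw0 : 0 < w := by linarith
  have hkw : (k n : ℝ) = w * w := (Real.mul_self_sqrt (Nat.cast_nonneg _)).symm
  have hn : (0 : ℝ) < n := by exact_mod_cast h5
  have hT0 : 0 < T := hF.tailDF_pos _
  have hnT : n * T ≤ w * w := by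
    rw [hkw, le_div_iff₀ hn] at h1; linarith
  have bound : ∀ z, -K' ≤ z → z ≤ K' → ∃ θ, w * |θ| ≤ min (η / 4) 1 ∧
      tailDF μ (Real.exp (x - z / w)) = T * (Real.exp (α * z / w) * (1 + θ)) ∧
      Real.exp (α * z / w) ≤ 2 := by
    intro z hz1 hz2
    obtain ⟨θ, hθ, he⟩ := h2 (-(z / w)) (by
      rw [abs_neg, abs_div, abs_of_pos hw0]
      exact div_le_div_of_nonneg_right (abs_le.2 ⟨hz1, hz2⟩) hw0.le)
    refine ⟨θ, hθ, ?_, ?_⟩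
    · rw [sub_eq_add_neg, he]
      congr 3; ring
    · refine le_trans (Real.exp_le_exp.2 ?_) h3.le
      gcongr
  obtain ⟨θt, hθt, et, bt⟩ := bound t (by linarith) ht
  obtain ⟨θs, hθs, es, bs⟩ := bound s hs (by linarith)
  have ht1 : w * |θt| ≤ η / 4 := hθt.trans (min_le_left _ _)
  have ht2 : |θt| ≤ 1 := by
    have := hθt.trans (min_le_right _ _)
    nlinarith [abs_nonneg θt]
  have hs1 : w * |θs| ≤ η / 4 := hθs.trans (min_le_left _ _)
  set Et := Real.exp (α * t / w) with hEt
  set Es := Real.exp (α * s / w) with hEs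
  have hEt0 : 0 < Et := Real.exp_pos _
  have hEs0 : 0 < Es := Real.exp_pos _
  rw [et, es]
  constructor
  · have hd : Et - Es ≤ 2 * α * (t - s) / w := by
      refine exp_sub_exp_le.trans ?_
      have : α * t / w - α * s / w = α * (t - s) / w := by ring
      rw [this, ← hEt]
      have : 0 ≤ α * (t - s) / w := div_nonneg (mul_nonneg hα.le (by linarith)) hw0.le
      calc Et * (α * (t - s) / w) ≤ 2 * (α * (t - s) / w) := mul_le_mul_of_nonneg_right bt this
        _ = _ := by ring
    have hbr : Et * (1 + θt) - Es * (1 + θs) ≤ (2 * α * (t - s) + η) / w := by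
      have a1 : Et * θt ≤ 2 * (η / 4 / w) := by
        have : |θt| ≤ η / 4 / w := by rw [le_div_iff₀ hw0]; linarith
        nlinarith [le_abs_self θt, abs_nonneg θt]
      have a2 : -(Es * θs) ≤ 2 * (η / 4 / w) := by
        have : |θs| ≤ η / 4 / w := by rw [le_div_iff₀ hw0]; linarith
        nlinarith [neg_abs_le θs, abs_nonneg θs]
      have : (2 * α * (t - s) + η) / w = 2 * α * (t - s) / w + 2 * (η / 4 / w) + 2 * (η / 4 / w) := by
        ring
      linarith
    have hpos : 0 ≤ (2 * α * (t - s) + η) / w :=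
      div_nonneg (by nlinarith) hw0.le
    calc n / w * (T * (Et * (1 + θt)) - T * (Es * (1 + θs)))
        = (n * T) / w * (Et * (1 + θt) - Es * (1 + θs)) := by ring
      _ ≤ (n * T) / w * ((2 * α * (t - s) + η) / w) :=
          mul_le_mul_of_nonneg_left hbr (by positivity)
      _ ≤ (w * w) / w * ((2 * α * (t - s) + η) / w) := by gcongr
      _ = _ := by field_simp
  · have : Et * (1 + θt) ≤ 4 := by nlinarith [le_abs_self θt]
    calc n / k n * (T * (Et * (1 + θt))) = (n * T) / (w * w) * (Et * (1 + θt)) := by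
          rw [hkw]; ring
      _ ≤ (n * T) / (w * w) * 4 := mul_le_mul_of_nonneg_left this (by positivity)
      _ ≤ 1 * 4 := by
          refine mul_le_mul_of_nonneg_right ?_ (by norm_num)
          rw [div_le_one (by positivity)]; exact hnT
      _ = 4 := by norm_num

end Tail

/-! ### Increments of the tail process -/

theorem monotone_phi1 : Monotone phi1 := fun x y h => by
  unfold phi1
  split_ifs <;> linarith

theorem monotone_phi2 : Monotone phi2 := fun _ _ h => max_le_max_right 0 h

theorem measurable_phi1 : Measurable phi1 :=
  Measurable.ite measurableSet_Ioi measurable_const measurable_const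

theorem measurable_phi2 : Measurable phi2 := measurable_id.max measurable_const

theorem phi2_sub_phi2_le {x y : ℝ} : phi2 y - phi2 x ≤ (y - x) * phi1 y := by
  unfold phi1 phi2
  split_ifs with hy
  · rw [max_eq_left hy.le]; linarith [le_max_left x 0]
  · rw [max_eq_right (not_lt.1 hy)]; linarith [le_max_right x 0]

theorem phi1_nonneg (x : ℝ) : 0 ≤ phi1 x := by unfold phi1; split_ifs <;> norm_num

theorem phi1_le_one (x : ℝ) : phi1 x ≤ 1 := by unfold phi1; split_ifs <;> norm_num

theorem IsStationary.map_eq {X : ℕ → Ω → ℝ} (hX : ∀ i, Measurable (X i)) (h : IsStationary X)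
    (i : ℕ) : Measure.map (X i) (ℙ : Measure Ω) = Measure.map (X 1) (ℙ : Measure Ω) := by
  have key : ∀ i, Measure.map (X i) (ℙ : Measure Ω) = Measure.map (X 0) (ℙ : Measure Ω) := by
    intro i
    have := congrArg (Measure.map fun x : ℕ → ℝ => x 0) (h i)
    rw [Measure.map_map (measurable_pi_apply 0) (measurable_pi_lambda _ fun _ => hX _),
      Measure.map_map (measurable_pi_apply 0) (measurable_pi_lambda _ fun _ => hX _)] at this
    simpa [Function.comp_def] using this
  rw [key i, key 1]

theorem integral_phi1_log_sub {Y : Ω → ℝ} (hY : Measurable Y) (hY0 : ∀ ω, 0 ≤ Y ω) {τ : ℝ}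
    (hτ : 0 ≤ τ) :
    ∫ ω, phi1 (Real.log (Y ω) - τ) = tailDF (Measure.map Y (ℙ : Measure Ω)) (Real.exp τ) := by
  have h : ∀ ω, phi1 (Real.log (Y ω) - τ)
      = (Y ⁻¹' Ioi (Real.exp τ)).indicator (fun _ => (1 : ℝ)) ω := by
    intro ω
    have hiff : 0 < Real.log (Y ω) - τ ↔ Real.exp τ < Y ω := by
      rw [sub_pos]
      constructor
      · intro h
        have : 0 < Y ω := lt_of_le_of_ne (hY0 ω) fun h0 => by
          rw [← h0, Real.log_zero] at h; linarith
        rwa [Real.lt_log_iff_exp_lt this] at h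
      · intro h
        rwa [Real.lt_log_iff_exp_lt ((Real.exp_pos τ).trans h)]
    by_cases hc : Real.exp τ < Y ω
    · rw [phi1, if_pos (hiff.2 hc), indicator_of_mem (by exact hc)]
    · rw [phi1, if_neg (mt hiff.1 hc), indicator_of_notMem (by exact hc)]
  simp only [h]
  rw [integral_indicator (hY measurableSet_Ioi), tailDF, Measure.map_apply hY measurableSet_Ioi]
  simp [Measure.real]

section Increments

variable [IsProbabilityMeasure (ℙ : Measure Ω)]

theorem eventually_integral_increment_le {Y : Ω → ℝ} (hY : Measurable Y) (hY0 : ∀ ω, 0 ≤ Y ω)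
    {α : ℝ} (hα : 0 < α) {l : ℝ → ℝ} (hF : ParetoTail (Measure.map Y (ℙ : Measure Ω)) α l)
    {k : ℕ → ℕ} (hk : TailFraction k) {g : ℝ → ℝ} {K γ A : ℝ}
    (hA2 : CondA2 l g K γ A (quantileB (Measure.map Y (ℙ : Measure Ω))) k)
    {φ : ℝ → ℝ} (hφ : φ = phi1 ∨ φ = phi2) (K' : ℝ) {η : ℝ} (hη : 0 < η) :
    ∀ᶠ n : ℕ in atTop, ∀ s t : ℝ, -K' ≤ s → s ≤ t → t ≤ K' →
      (n : ℝ) / Real.sqrt (k n) * ∫ ω,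
        (φ (Real.log (Y ω) - Real.log (quantileB (Measure.map Y (ℙ : Measure Ω)) ((n : ℝ) / k n))
            + t / Real.sqrt (k n))
          - φ (Real.log (Y ω) - Real.log (quantileB (Measure.map Y (ℙ : Measure Ω)) ((n : ℝ) / k n))
            + s / Real.sqrt (k n)))
        ≤ (2 * α + 4) * (t - s) + η := by
  have := Measure.isProbabilityMeasure_map (μ := (ℙ : Measure Ω)) hY.aemeasurable
  set μ := Measure.map Y (ℙ : Measure Ω) with hμ
  filter_upwards [eventually_tailDF_increment_le hα hF hk hA2 K' hη,
    hk.tendsto_sqrt.eventually_ge_atTop 1, hk.tendsto_sqrt.eventually_ge_atTop K',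
    (hF.tendsto_log_quantileB hk).eventually_ge_atTop 1] with n h1 h2 h3 h4 s t hs hst ht
  set x := Real.log (quantileB μ ((n : ℝ) / k n)) with hx
  set w := Real.sqrt (k n) with hw
  have hw0 : 0 < w := by linarith
  have hkw : (k n : ℝ) = w * w := (Real.mul_self_sqrt (Nat.cast_nonneg _)).symm
  obtain ⟨hinc, htail⟩ := h1 s t hs hst ht
  have hτ : ∀ z, z ≤ K' → 0 ≤ x - z / w := fun z hz => by
    have : z / w ≤ 1 := by rw [div_le_one hw0]; linarith
    linarith
  have hshift : ∀ z y : ℝ, y - x + z / w = y - (x - z / w) := fun z y => by ring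
  have hI : ∀ z, z ≤ K' → ∫ ω, phi1 (Real.log (Y ω) - x + z / w)
      = tailDF μ (Real.exp (x - z / w)) := fun z hz => by
    simp only [hshift]
    exact integral_phi1_log_sub hY hY0 (hτ z hz)
  have hm : ∀ z, Measurable fun ω => Real.log (Y ω) - x + z / w := fun z =>
    ((Real.measurable_log.comp hY).sub_const x).add_const _
  have hint : ∀ z, Integrable fun ω => phi1 (Real.log (Y ω) - x + z / w) := fun z =>
    Integrable.of_bound (measurable_phi1.comp (hm z)).aestronglyMeasurable 1
      (Eventually.of_forall fun ω => by
        rw [Real.norm_eq_abs, abs_of_nonneg (phi1_nonneg _)]; exact phi1_le_one _)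
  rcases hφ with rfl | rfl
  · rw [integral_sub (hint t) (hint s), hI t ht, hI s (by linarith)]
    nlinarith
  · have hts : s / w ≤ t / w := div_le_div_of_nonneg_right hst hw0.le
    have hle : ∫ ω, (phi2 (Real.log (Y ω) - x + t / w) - phi2 (Real.log (Y ω) - x + s / w))
        ≤ (t - s) / w * tailDF μ (Real.exp (x - t / w)) := by
      rw [← hI t ht, ← integral_const_mul]
      refine integral_mono_of_nonneg (Eventually.of_forall fun ω =>
        sub_nonneg.2 (monotone_phi2 (by linarith))) ((hint t).const_mul _)
        (Eventually.of_forall fun ω => ?_)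
      refine phi2_sub_phi2_le.trans (le_of_eq ?_)
      ring
    calc _ ≤ n / w * ((t - s) / w * tailDF μ (Real.exp (x - t / w))) :=
          mul_le_mul_of_nonneg_left hle (by positivity)
      _ = (t - s) * (n / k n * tailDF μ (Real.exp (x - t / w))) := by rw [hkw]; field_simp
      _ ≤ (t - s) * 4 := mul_le_mul_of_nonneg_left htail (by linarith)
      _ ≤ _ := by nlinarith

theorem tendsto_measure_lt_sum_increment {X : ℕ → Ω → ℝ} (hX : ∀ i, Measurable (X i))
    (hmap : ∀ i, Measure.map (X i) (ℙ : Measure Ω) = Measure.map (X 1) (ℙ : Measure Ω))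
    {k r : ℕ → ℕ} (hk : TailFraction k) (hA1 : CondA1 X k r) {b : ℝ → ℝ}
    {φ : ℝ → ℝ} (hφ : φ = phi1 ∨ φ = phi2) {s t ε : ℝ} (hst : s ≤ t) (hε : 0 < ε)
    (hmean : ∀ᶠ n : ℕ in atTop, 24 * ((n : ℝ) / Real.sqrt (k n) *
      ∫ ω, (An X b φ n (k n) t 1 ω - An X b φ n (k n) s 1 ω)) ≤ ε) :
    Tendsto (fun n : ℕ => (ℙ : Measure Ω).real {ω | ε < (Real.sqrt (k n))⁻¹ *
      ∑ i ∈ Finset.Icc 1 n, (An X b φ n (k n) t i ω - An X b φ n (k n) s i ω)}) atTop (nhds 0) := by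
  obtain ⟨hr0, hβ, hrk⟩ := hA1
  have hw := hk.tendsto_sqrt
  have hβ1 : Tendsto (fun n : ℕ => (n : ℝ) / r n * betaMix X (r n)) atTop (nhds 0) := by
    simpa using hβ 1 one_pos
  have hrw : Tendsto (fun n => (r n : ℝ) / Real.sqrt (k n)) atTop (nhds 0) := by
    have := (Real.continuous_sqrt.tendsto 0).comp hrk
    rw [Real.sqrt_zero] at this
    refine this.congr fun n => ?_
    simp only [Function.comp]
    rw [Real.sqrt_div (sq_nonneg _), Real.sqrt_sq (Nat.cast_nonneg _)]
  have hrn : ∀ᶠ n : ℕ in atTop, r n ≤ n := by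
    filter_upwards [hrk.eventually (eventually_lt_nhds one_pos),
      hk.tendsto_div.eventually_ge_atTop 1, hk.1.eventually_gt_atTop 0] with n h1 h2 h3
    rw [div_lt_one h3] at h1
    rw [one_le_div h3] at h2
    have h4 : (1 : ℝ) ≤ r n := by exact_mod_cast hr0 n
    have : (r n : ℝ) ≤ n := by nlinarith
    exact_mod_cast this
  have hφm : Measurable φ := by
    rcases hφ with rfl | rfl
    exacts [measurable_phi1, measurable_phi2]
  have hφmono : Monotone φ := by
    rcases hφ with rfl | rfl
    exacts [monotone_phi1, monotone_phi2]
  have hφone : ∀ x y, x ≤ y → y - x ≤ 1 → φ y - φ x ≤ 1 := by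
    intro x y hxy h1
    rcases hφ with rfl | rfl
    · linarith [phi1_le_one y, phi1_nonneg x]
    · refine phi2_sub_phi2_le.trans ?_
      nlinarith [phi1_le_one y, phi1_nonneg y]
  have bound : ∀ τ : ℝ, 0 ≤ τ → ∀ᶠ n : ℕ in atTop,
      (ℙ : Measure Ω).real {ω | ε < (Real.sqrt (k n))⁻¹ *
        ∑ i ∈ Finset.Icc 1 n, (An X b φ n (k n) t i ω - An X b φ n (k n) s i ω)}
      ≤ 2 * Real.exp (-(τ * ε / 4))
        + 12 * Real.exp (τ * ε / 4) * ((n : ℝ) / r n * betaMix X (r n)) := by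
    intro τ hτ
    have hτr : Tendsto (fun n => τ * ((r n : ℝ) / Real.sqrt (k n))) atTop (nhds 0) := by
      simpa using hrw.const_mul τ
    filter_upwards [hmean, hrn, hτr.eventually (eventually_lt_nhds one_pos),
      hw.eventually_ge_atTop (t - s), hw.eventually_gt_atTop 0] with n h1 h2 h3 h4 h5
    set w := Real.sqrt (k n) with hwdef
    set x := Real.log (b ((n : ℝ) / k n)) with hx
    set ψ : ℝ → ℝ := fun y =>
      w⁻¹ * (φ (Real.log y - x + t / w) - φ (Real.log y - x + s / w)) with hψ
    have hm : ∀ z, Measurable fun y => φ (Real.log y - x + z / w) := fun z =>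
      hφm.comp ((Real.measurable_log.sub_const x).add_const _)
    have hψm : Measurable ψ := ((hm t).sub (hm s)).const_mul _
    have hts : s / w ≤ t / w := div_le_div_of_nonneg_right hst h5.le
    have hts1 : t / w - s / w ≤ 1 := by rw [← sub_div, div_le_one h5]; exact h4
    have hψ0 : ∀ y, 0 ≤ ψ y := fun y =>
      mul_nonneg (inv_nonneg.2 h5.le) (sub_nonneg.2 (hφmono (by linarith)))
    have hψ1 : ∀ y, ψ y ≤ w⁻¹ := fun y =>
      mul_le_of_le_one_right (inv_nonneg.2 h5.le) (hφone _ _ (by linarith) (by linarith))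
    have hsum : ∀ ω, w⁻¹ * ∑ i ∈ Finset.Icc 1 n,
        (An X b φ n (k n) t i ω - An X b φ n (k n) s i ω)
        = ∑ i ∈ Finset.Icc 1 n, ψ (X i ω) := fun ω => by
      rw [Finset.mul_sum]; rfl
    simp only [hsum]
    refine measure_lt_sum_Icc_le hX hψm hψ0 (μ := ∫ ω, ψ (X 1 ω)) hψ1 hτ hε.le ?_ (fun i => ?_)
      (hr0 n) h2 ?_
    · rw [← div_eq_mul_inv]; exact h3.le
    · rw [← integral_map (hX i).aemeasurable hψm.aestronglyMeasurable, hmap i,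
        integral_map (hX 1).aemeasurable hψm.aestronglyMeasurable]
    · have : ∫ ω, ψ (X 1 ω)
          = w⁻¹ * ∫ ω, (An X b φ n (k n) t 1 ω - An X b φ n (k n) s 1 ω) := by
        rw [← integral_const_mul]; rfl
      rw [this]
      refine le_trans (le_of_eq ?_) h1
      ring
  rw [Metric.tendsto_nhds]
  intro δ hδ
  have hexp : Tendsto (fun τ : ℝ => 2 * Real.exp (-(τ * ε / 4))) atTop (nhds 0) := by
    have : Tendsto (fun τ : ℝ => τ * (ε / 4)) atTop atTop :=
      tendsto_id.atTop_mul_const (by positivity)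
    have h2 := (Real.tendsto_exp_neg_atTop_nhds_zero.comp this).const_mul 2
    rw [mul_zero] at h2
    exact h2.congr fun τ => by simp only [Function.comp]; congr 3; ring
  obtain ⟨τ, hτ1, hτ0⟩ := ((hexp.eventually (eventually_lt_nhds (half_pos hδ))).and
    (eventually_ge_atTop 0)).exists
  have hlim := hβ1.const_mul (12 * Real.exp (τ * ε / 4))
  rw [mul_zero] at hlim
  filter_upwards [bound τ hτ0, hlim.eventually (eventually_lt_nhds (half_pos hδ))] with n h1 h2
  rw [Real.dist_eq, sub_zero, abs_of_nonneg measureReal_nonneg]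
  linarith

end Increments

theorem limsup_mem_Icc_of_eventually_le {u : ℕ → ℝ} {c : ℝ} (h0 : ∀ n, 0 ≤ u n)
    (h : ∀ᶠ n in atTop, u n ≤ c) : limsup u atTop ∈ Icc 0 c := by
  have hb : IsBoundedUnder (· ≤ ·) atTop u := ⟨c, by simpa using h⟩
  have hcb : IsCoboundedUnder (· ≤ ·) atTop u :=
    IsBoundedUnder.isCoboundedUnder_le (isBoundedUnder_of ⟨0, h0⟩)
  exact ⟨le_limsup_of_frequently_le (Frequently.of_forall h0) hb, limsup_le_of_le hcb h⟩

/-- Any two points of `[-K, K]` at distance less than `ρ` lie in a common interval formed by two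
adjacent cells of the grid of mesh `ρ` based at `-K`. -/
theorem exists_grid_bracket {K ρ s t : ℝ} (hρ : 0 < ρ) (hs : -K ≤ s) (hsK : s ≤ K)
    (hd : t - s < ρ) :
    ∃ j ∈ Finset.range (⌊2 * K / ρ⌋₊ + 1), -K + j * ρ ≤ s ∧ t ≤ -K + j * ρ + 2 * ρ := by
  have h0 : 0 ≤ (s + K) / ρ := div_nonneg (by linarith) hρ.le
  refine ⟨⌊(s + K) / ρ⌋₊, ?_, ?_, ?_⟩
  · rw [Finset.mem_range, Nat.lt_succ_iff]
    exact Nat.floor_mono (div_le_div_of_nonneg_right (by linarith) hρ.le)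
  · have := Nat.floor_le h0
    rw [le_div_iff₀ hρ] at this
    linarith
  · have := Nat.lt_floor_add_one ((s + K) / ρ)
    rw [div_lt_iff₀ hρ] at this
    linarith

/-- Lemma 4 of Kim–Lee (2009): equicontinuity in `ζ` of the partial sums of
`A_i(ζ) = φ(log X_i - log b(n/k) + ζ/√k)` over `[-K, K]`. -/
theorem An_equicontinuity
    {Ω : Type*} [MeasureSpace Ω] [IsProbabilityMeasure (ℙ : Measure Ω)]
    (X : ℕ → Ω → ℝ) (hmeas : ∀ i, Measurable (X i)) (hpos : ∀ i ω, 0 ≤ X i ω)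
    (hstat : IsStationary X)
    (α : ℝ) (hα : 0 < α) (l : ℝ → ℝ)
    (hF : ParetoTail (Measure.map (X 1) (ℙ : Measure Ω)) α l)
    (k r : ℕ → ℕ) (hk : TailFraction k)
    (hA1 : CondA1 X k r)
    (g : ℝ → ℝ) (K γ A : ℝ)
    (hA2 : CondA2 l g K γ A (quantileB (Measure.map (X 1) (ℙ : Measure Ω))) k)
    (χ ωc : ℝ)
    (hA3 : CondA3 X (quantileB (Measure.map (X 1) (ℙ : Measure Ω))) k r α χ ωc)
    (φ : ℝ → ℝ) (hφ : φ = phi1 ∨ φ = phi2) (K₀ : ℝ) (hK₀ : 0 < K₀) :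
    (∀ ε : ℝ, 0 < ε →
      Tendsto (fun ρ : ℝ =>
          Filter.limsup (fun n : ℕ =>
            ((ℙ : Measure Ω) {ω | ε <
              ⨆ q : {q : ℝ × ℝ // q.1 ∈ Icc (-K₀) K₀ ∧ q.2 ∈ Icc (-K₀) K₀ ∧ |q.1 - q.2| < ρ},
                (Real.sqrt (k n))⁻¹ * ∑ i ∈ Finset.Icc 1 n,
                  |An X (quantileB (Measure.map (X 1) (ℙ : Measure Ω))) φ n (k n) (q : ℝ × ℝ).2 i ω
                    - An X (quantileB (Measure.map (X 1) (ℙ : Measure Ω))) φ n (k n) (q : ℝ × ℝ).1 i ω|}).toReal) atTop)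
        (nhdsWithin 0 (Ioi (0 : ℝ))) (nhds 0)) ∧
    (Tendsto (fun ρ : ℝ =>
        Filter.limsup (fun n : ℕ =>
          ⨆ q : {q : ℝ × ℝ // q.1 ∈ Icc (-K₀) K₀ ∧ q.2 ∈ Icc (-K₀) K₀ ∧ |q.1 - q.2| < ρ},
            ((n : ℝ) / Real.sqrt (k n)) *
              ∫ ω, |An X (quantileB (Measure.map (X 1) (ℙ : Measure Ω))) φ n (k n) (q : ℝ × ℝ).2 1 ω
                - An X (quantileB (Measure.map (X 1) (ℙ : Measure Ω))) φ n (k n) (q : ℝ × ℝ).1 1 ω|) atTop)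
      (nhdsWithin 0 (Ioi (0 : ℝ))) (nhds 0)) := by
  set b := quantileB (Measure.map (X 1) (ℙ : Measure Ω)) with hb
  have hmono : Monotone φ := by
    rcases hφ with rfl | rfl
    exacts [monotone_phi1, monotone_phi2]
  have hAmono : ∀ n i ω, Monotone fun ζ => An X b φ n (k n) ζ i ω := fun n i ω s t hst =>
    hmono (add_le_add_right (div_le_div_of_nonneg_right hst (Real.sqrt_nonneg _)) _)
  set C := 2 * α + 4 with hC
  have hC0 : 0 < C := by positivity
  have hmean : ∀ η : ℝ, 0 < η → ∀ᶠ n : ℕ in atTop, ∀ s t : ℝ, -(K₀ + 2) ≤ s → s ≤ t →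
      t ≤ K₀ + 2 → (n : ℝ) / Real.sqrt (k n) *
        ∫ ω, (An X b φ n (k n) t 1 ω - An X b φ n (k n) s 1 ω) ≤ C * (t - s) + η := fun η hη =>
    eventually_integral_increment_le (hmeas 1) (hpos 1) hα hF hk hA2 hφ (K₀ + 2) hη
  constructor
  · intro ε hε
    refine tendsto_const_nhds.congr' ?_
    filter_upwards [Ioo_mem_nhdsGT (lt_min zero_lt_one (by positivity : 0 < ε / (96 * C)))]
      with ρ hρ
    obtain ⟨hρ0, hρ1⟩ := hρ
    have hρle : ρ ≤ 1 := (hρ1.trans_le (min_le_left _ _)).le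
    have hρε : 96 * (C * ρ) ≤ ε := by
      have := (hρ1.trans_le (min_le_right _ _)).le
      rw [le_div_iff₀ (by positivity)] at this
      linarith
    set N := ⌊2 * K₀ / ρ⌋₊ + 1 with hN
    have hjle : ∀ j ∈ Finset.range N, (j : ℝ) * ρ ≤ 2 * K₀ := by
      intro j hj
      rw [hN, Finset.mem_range, Nat.lt_succ_iff, Nat.le_floor_iff (by positivity),
        le_div_iff₀ hρ0] at hj
      exact hj
    have hpair : ∀ j ∈ Finset.range N, Tendsto (fun n : ℕ => (ℙ : Measure Ω).real
        {ω | ε < (Real.sqrt (k n))⁻¹ * ∑ i ∈ Finset.Icc 1 n,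
          (An X b φ n (k n) (-K₀ + j * ρ + 2 * ρ) i ω - An X b φ n (k n) (-K₀ + j * ρ) i ω)})
        atTop (nhds 0) := by
      intro j hj
      refine tendsto_measure_lt_sum_increment hmeas (hstat.map_eq hmeas) hk hA1 hφ
        (by linarith) hε ?_
      filter_upwards [hmean (ε / 48) (by positivity)] with n hn
      have hj0 : 0 ≤ (j : ℝ) * ρ := by positivity
      have := hn (-K₀ + j * ρ) (-K₀ + j * ρ + 2 * ρ) (by linarith) (by linarith)
        (by linarith [hjle j hj])
      have e : C * (-K₀ + j * ρ + 2 * ρ - (-K₀ + j * ρ)) = 2 * (C * ρ) := by ring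
      rw [e] at this
      linarith
    have hsum := tendsto_finsetSum (Finset.range N) hpair
    simp only [Finset.sum_const_zero] at hsum
    symm
    refine (squeeze_zero (fun n => ENNReal.toReal_nonneg) (fun n => ?_) hsum).limsup_eq
    refine (measureReal_mono (s₂ := ⋃ j ∈ Finset.range N, {ω | ε < (Real.sqrt (k n))⁻¹ *
      ∑ i ∈ Finset.Icc 1 n, (An X b φ n (k n) (-K₀ + j * ρ + 2 * ρ) i ω
        - An X b φ n (k n) (-K₀ + j * ρ) i ω)}) ?_ (measure_ne_top _ _)).trans (measureReal_biUnion_finset_le _ _)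
    intro ω hω
    by_contra hcon
    simp only [mem_iUnion, mem_ofPred_eq, not_exists, not_lt] at hcon hω
    refine hω.not_ge (Real.iSup_le (fun q => ?_) hε.le)
    have key : ∀ s t : ℝ, -K₀ ≤ s → s ≤ K₀ → s ≤ t → t - s < ρ → (Real.sqrt (k n))⁻¹ *
        ∑ i ∈ Finset.Icc 1 n, |An X b φ n (k n) t i ω - An X b φ n (k n) s i ω| ≤ ε := by
      intro s t h1 h2 h3 h4
      obtain ⟨j, hj, hjs, hjt⟩ := exists_grid_bracket hρ0 h1 h2 h4
      refine le_trans (mul_le_mul_of_nonneg_left (Finset.sum_le_sum fun i _ => ?_)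
        (inv_nonneg.2 (Real.sqrt_nonneg _))) (hcon j hj)
      rw [abs_of_nonneg (sub_nonneg.2 (hAmono n i ω h3))]
      exact sub_le_sub (hAmono n i ω hjt) (hAmono n i ω hjs)
    obtain ⟨⟨s, t⟩, hs, ht, hd⟩ := q
    rcases le_total s t with h | h
    · exact key s t hs.1 hs.2 h (by rw [abs_lt] at hd; linarith [hd.1])
    · simp only [abs_sub_comm (An X b φ n (k n) t _ ω)]
      exact key t s ht.1 ht.2 h (by rw [abs_lt] at hd; linarith [hd.2])
  · have hupper : Tendsto (fun ρ : ℝ => (C + 1) * ρ) (nhdsWithin 0 (Ioi 0)) (nhds 0) := by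
      have : Tendsto (fun ρ : ℝ => (C + 1) * ρ) (nhds 0) (nhds ((C + 1) * 0)) :=
        tendsto_id.const_mul _
      rw [mul_zero] at this
      exact this.mono_left nhdsWithin_le_nhds
    have hmem : ∀ᶠ ρ : ℝ in nhdsWithin 0 (Ioi 0), limsup (fun n : ℕ =>
        ⨆ q : {q : ℝ × ℝ // q.1 ∈ Icc (-K₀) K₀ ∧ q.2 ∈ Icc (-K₀) K₀ ∧ |q.1 - q.2| < ρ},
          ((n : ℝ) / Real.sqrt (k n)) * ∫ ω, |An X b φ n (k n) (q : ℝ × ℝ).2 1 ω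
            - An X b φ n (k n) (q : ℝ × ℝ).1 1 ω|) atTop ∈ Icc 0 ((C + 1) * ρ) := by
      filter_upwards [self_mem_nhdsWithin] with ρ hρ
      have hρ0 : 0 < ρ := hρ
      refine limsup_mem_Icc_of_eventually_le (fun n => Real.iSup_nonneg fun q =>
        mul_nonneg (by positivity) (integral_nonneg fun _ => abs_nonneg _)) ?_
      filter_upwards [hmean ρ hρ0] with n hn
      refine Real.iSup_le (fun q => ?_) (by positivity)
      have key : ∀ s t : ℝ, -K₀ ≤ s → t ≤ K₀ → s ≤ t → t - s < ρ → (n : ℝ) / Real.sqrt (k n) *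
          ∫ ω, |An X b φ n (k n) t 1 ω - An X b φ n (k n) s 1 ω| ≤ (C + 1) * ρ := by
        intro s t h1 h2 h3 h4
        have e : ∀ ω, |An X b φ n (k n) t 1 ω - An X b φ n (k n) s 1 ω|
            = An X b φ n (k n) t 1 ω - An X b φ n (k n) s 1 ω := fun ω =>
          abs_of_nonneg (sub_nonneg.2 (hAmono n 1 ω h3))
        simp only [e]
        refine (hn s t (by linarith) h3 (by linarith)).trans ?_
        nlinarith
      obtain ⟨⟨s, t⟩, hs, ht, hd⟩ := q
      rcases le_total s t with h | h
      · exact key s t hs.1 ht.2 h (by rw [abs_lt] at hd; linarith [hd.1])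
      · simp only [abs_sub_comm (An X b φ n (k n) t _ _)]
        exact key t s ht.1 hs.2 h (by rw [abs_lt] at hd; linarith [hd.2])
    exact tendsto_of_tendsto_of_tendsto_of_le_of_le' tendsto_const_nhds hupper
      (hmem.mono fun _ h => h.1) (hmem.mono fun _ h => h.2)

end TailCusum
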